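/- arXiv:math/0503739 — 10 statements merged into one kernel-verified Lean document; each statement's English description precedes it below -/
import Mathlib

section
/- Let j ≥ 0 be an integer and let R ∈ End_{j+2}(V̄). Then there exists T ∈ End_j(V̄) such that R = T∘ν − ν∘T. -/
namespace GradedLefschetz

open DirectSum

section TraceDuality

variable {k V : Type*} [Field k] [AddCommGroup V] [Module k V] [FiniteDimensional k V]

/-- The trace pairing on endomorphisms is nondegenerate. -/
theorem eq_zero_of_trace_mul_eq_zero (S : Module.End k V)
    (h : ∀ T : Module.End k V, LinearMap.trace k V (S * T) = 0) : S = 0 := by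
  ext v
  refine (Module.forall_dual_apply_eq_zero_iff k (S v)).1 fun φ => ?_
  have hmul : S * φ.smulRight v = φ.smulRight (S v) := by
    ext w
    simp
  rw [← LinearMap.trace_smulRight, ← hmul]
  exact h _

/-- Every linear functional on endomorphisms is a trace pairing. -/
theorem exists_eq_trace_mul (f : Module.Dual k (Module.End k V)) :
    ∃ S : Module.End k V, ∀ T, f T = LinearMap.trace k V (S * T) := by
  let Φ : Module.End k V →ₗ[k] Module.Dual k (Module.End k V) :=
    (LinearMap.mul k (Module.End k V)).compr₂ (LinearMap.trace k V)
  have hinj : Function.Injective Φ := (injective_iff_map_eq_zero Φ).2 fun S hS =>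
    eq_zero_of_trace_mul_eq_zero S fun T => LinearMap.congr_fun hS T
  obtain ⟨S, hS⟩ := (LinearMap.injective_iff_surjective_of_finrank_eq_finrank
    Subspace.dual_finrank_eq.symm).1 hinj f
  exact ⟨S, fun T => (LinearMap.congr_fun hS T).symm⟩

/-- An endomorphism that is trace-orthogonal to the commutant of `ν` is a commutator with `ν`. -/
theorem exists_eq_commutator (ν R : Module.End k V)
    (h : ∀ S : Module.End k V, Commute S ν → LinearMap.trace k V (S * R) = 0) :
    ∃ T : Module.End k V, R = T * ν - ν * T := by
  let ad : Module.End k V →ₗ[k] Module.End k V :=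
    LinearMap.mulRight k ν - LinearMap.mulLeft k ν
  by_contra hne
  have hR : R ∉ LinearMap.range ad := fun ⟨T, hT⟩ => hne ⟨T, hT.symm⟩
  obtain ⟨f, hfR, hf⟩ := Submodule.exists_le_ker_of_notMem hR
  obtain ⟨S, hS⟩ := exists_eq_trace_mul f
  refine hfR ((hS R).trans (h S ?_))
  have hcomm : ν * S - S * ν = 0 := eq_zero_of_trace_mul_eq_zero _ fun T => by
    have hT : f (T * ν - ν * T) = 0 := hf ⟨T, rfl⟩
    rw [hS, mul_sub, map_sub, ← mul_assoc, LinearMap.trace_mul_comm, ← mul_assoc, ← mul_assoc,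
      ← map_sub, ← sub_mul] at hT
    exact hT
  exact (sub_eq_zero.1 hcomm).symm

end TraceDuality

variable {k V : Type*} [Field k] [AddCommGroup V] [Module k V] (Vgr : ℤ → Submodule k V)

/-- The decreasing filtration attached to a grading: the sum of the pieces of degree at least `a`. -/
def filtration (a : ℤ) : Submodule k V := ⨆ b, ⨆ _ : a ≤ b, Vgr b

variable {Vgr}

theorem le_filtration {a b : ℤ} (h : a ≤ b) : Vgr b ≤ filtration Vgr a :=
  le_iSup₂_of_le b h le_rfl

theorem filtration_antitone : Antitone (filtration Vgr) := fun _ _ h =>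
  iSup₂_le fun _ hb => le_filtration (h.trans hb)

theorem map_filtration_le {f : Module.End k V} {d : ℤ}
    (hf : ∀ a, ∀ x ∈ Vgr a, f x ∈ filtration Vgr (a + d)) (a : ℤ) :
    (filtration Vgr a).map f ≤ filtration Vgr (a + d) := by
  rw [Submodule.map_le_iff_le_comap]
  exact iSup₂_le fun b hb x hx => filtration_antitone (by lia) (hf b x hx)

/-- An endomorphism that strictly raises the filtration of a bounded grading is nilpotent. -/
theorem isNilpotent_of_mapsTo_filtration (htop : iSup Vgr = ⊤) {B : ℕ}
    (hB : ∀ a : ℤ, (B : ℤ) < |a| → Vgr a = ⊥) {f : Module.End k V}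
    (hf : ∀ a, ∀ x ∈ Vgr a, f x ∈ filtration Vgr (a + 1)) : IsNilpotent f := by
  have hmap (n : ℕ) (x : V) : (f ^ n) x ∈ filtration Vgr (-(B : ℤ) + n) := by
    induction n with
    | zero =>
      have hle : iSup Vgr ≤ filtration Vgr (-(B : ℤ)) := iSup_le fun b => by
        by_cases hb : -(B : ℤ) ≤ b
        · exact le_filtration hb
        · simp [hB b (lt_abs.2 (by lia))]
      simpa using hle (htop ▸ Submodule.mem_top : x ∈ iSup Vgr)
    | succ n ih =>
      rw [pow_succ', Nat.cast_succ, ← add_assoc]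
      exact map_filtration_le hf _ ⟨_, ih, rfl⟩
  refine ⟨2 * B + 1, LinearMap.ext fun x => ?_⟩
  have hbot : filtration Vgr (-(B : ℤ) + (2 * B + 1 : ℕ)) = ⊥ :=
    iSup₂_eq_bot.2 fun b hb => hB b (lt_abs.2 (by push_cast at hb; lia))
  have hx := hmap (2 * B + 1) x
  rwa [hbot, Submodule.mem_bot] at hx

theorem pow_apply_mem {ν : Module.End k V} (hdeg : ∀ a, ∀ x ∈ Vgr a, ν x ∈ Vgr (a + 2))
    (n : ℕ) {a : ℤ} {x : V} (hx : x ∈ Vgr a) : (ν ^ n) x ∈ Vgr (a + 2 * n) := by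
  induction n with
  | zero => simpa using hx
  | succ n ih =>
    rw [pow_succ', show a + 2 * ((n + 1 : ℕ) : ℤ) = a + 2 * n + 2 by push_cast; ring]
    exact hdeg _ _ ih

variable [Decomposition Vgr]

theorem mem_filtration_of_decompose_eq_zero {a : ℤ} {x : V}
    (h : ∀ b < a, (decompose Vgr x b : V) = 0) : x ∈ filtration Vgr a := by
  classical
  rw [← sum_support_decompose Vgr x]
  refine Submodule.sum_mem _ fun b _ => ?_
  rcases lt_or_ge b a with hb | hb
  · simp [h b hb]
  · exact le_filtration hb (decompose Vgr x b).2

/-- A homogeneous endomorphism of degree `d` commutes with taking components. -/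
theorem decompose_apply_add {f : Module.End k V} {d : ℤ}
    (hf : ∀ a, ∀ x ∈ Vgr a, f x ∈ Vgr (a + d)) (x : V) (b : ℤ) :
    (decompose Vgr (f x) (b + d) : V) = f (decompose Vgr x b) := by
  induction x using Decomposition.inductionOn Vgr with
  | zero => simp
  | @homogeneous a m =>
    rcases eq_or_ne a b with rfl | hab
    · rw [decompose_of_mem_same Vgr (hf _ _ m.2), decompose_of_mem_same Vgr m.2]
    · rw [decompose_of_mem_ne Vgr (hf _ _ m.2) (by lia), decompose_of_mem_ne Vgr m.2 hab, map_zero]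
  | add m m' hm hm' => simp [hm, hm']

/-- An endomorphism commuting with a Lefschetz operator preserves the degree filtration. -/
theorem apply_mem_filtration_of_commute {B : ℕ} (hB : ∀ a : ℤ, (B : ℤ) < |a| → Vgr a = ⊥)
    {ν : Module.End k V} (hdeg : ∀ a, ∀ x ∈ Vgr a, ν x ∈ Vgr (a + 2))
    (hLefInj : ∀ n : ℕ, ∀ x ∈ Vgr (-(n : ℤ)), (ν ^ n) x = 0 → x = 0)
    (hLefSurj : ∀ n : ℕ, ∀ y ∈ Vgr (n : ℤ), ∃ x ∈ Vgr (-(n : ℤ)), (ν ^ n) x = y)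
    {S : Module.End k V} (hS : Commute S ν) {a : ℤ} {x : V} (hx : x ∈ Vgr a) :
    S x ∈ filtration Vgr a := by
  have hcomm (n : ℕ) (y : V) : S ((ν ^ n) y) = (ν ^ n) (S y) :=
    LinearMap.congr_fun (hS.pow_right n).eq y
  -- A primitive vector of degree `-n` is killed by `ν ^ (n + 1)`, which is injective below `-n`.
  have hprim (n : ℕ) (p : V) (hp : (ν ^ (n + 1)) p = 0) : S p ∈ filtration Vgr (-(n : ℤ)) := by
    refine mem_filtration_of_decompose_eq_zero fun b hb => ?_
    obtain ⟨i, rfl⟩ : ∃ i : ℕ, b = -((i + (n + 1) : ℕ) : ℤ) :=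
      ⟨(-b - n - 1).toNat, by push_cast; lia⟩
    refine hLefInj _ _ (decompose Vgr (S p) _).2 ?_
    rw [pow_add, Module.End.mul_apply,
      ← decompose_apply_add (fun _ _ h => pow_apply_mem hdeg (n + 1) h), ← hcomm, hp]
    simp
  have hneg (m : ℕ) : ∀ n : ℕ, B < n + m → ∀ y ∈ Vgr (-(n : ℤ)),
      S y ∈ filtration Vgr (-(n : ℤ)) := by
    induction m with
    | zero =>
      intro n hn y hy
      rw [hB _ (lt_abs.2 (by lia)), Submodule.mem_bot] at hy
      simp [hy]
    | succ m ih =>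
      intro n hn y hy
      have hy' : (ν ^ (n + 1)) y ∈ Vgr ((n + 2 : ℕ) : ℤ) := by
        have := pow_apply_mem hdeg (n + 1) hy
        rwa [show -(n : ℤ) + 2 * ((n + 1 : ℕ) : ℤ) = ((n + 2 : ℕ) : ℤ) by push_cast; ring] at this
      obtain ⟨z, hz, hzy⟩ := hLefSurj (n + 2) _ hy'
      have hp : (ν ^ (n + 1)) (y - ν z) = 0 := by
        rw [map_sub, ← hzy, pow_succ ν (n + 1), Module.End.mul_apply, sub_self]
      have hνz : S (ν z) ∈ filtration Vgr (-(n : ℤ)) := by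
        have := map_filtration_le (fun a x hx => le_filtration le_rfl (hdeg a x hx)) _
          (Submodule.mem_map_of_mem (f := ν) (ih (n + 2) (by lia) z hz))
        rw [show -((n + 2 : ℕ) : ℤ) + 2 = -(n : ℤ) by push_cast; ring] at this
        simpa using (hcomm 1 z).symm ▸ this
      simpa using add_mem (hprim n _ hp) hνz
  rcases le_total a 0 with ha | ha
  · obtain ⟨n, rfl⟩ : ∃ n : ℕ, a = -(n : ℤ) := ⟨(-a).toNat, by lia⟩
    exact hneg (B + 1) n (by lia) x hx
  · lift a to ℕ using ha
    obtain ⟨y, hy, rfl⟩ := hLefSurj a x hx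
    have := map_filtration_le (fun b x hx => le_filtration le_rfl (pow_apply_mem hdeg a hx)) _
      (Submodule.mem_map_of_mem (f := ν ^ a) (hneg (B + 1) a (by lia) y hy))
    rw [show -(a : ℤ) + 2 * (a : ℤ) = a by ring] at this
    rwa [hcomm]

variable (Vgr) in
/-- The degree `d` component of an endomorphism of a graded vector space. -/
noncomputable def degreePart (d : ℤ) (T : Module.End k V) : Module.End k V :=
  toModule k ℤ V (fun a => (Vgr (a + d)).subtype ∘ₗ component k ℤ (fun i => Vgr i) (a + d) ∘ₗ
    (decomposeLinearEquiv Vgr).toLinearMap ∘ₗ T ∘ₗ (Vgr a).subtype) ∘ₗ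
    (decomposeLinearEquiv Vgr).toLinearMap

theorem degreePart_apply {d a : ℤ} (T : Module.End k V) {x : V} (hx : x ∈ Vgr a) :
    degreePart Vgr d T x = decompose Vgr (T x) (a + d) := by
  lift x to Vgr a using hx
  simp only [degreePart, LinearMap.comp_apply, LinearEquiv.coe_coe,
    decomposeLinearEquiv_apply_coe, toModule_lof]
  rfl

end GradedLefschetz

open GradedLefschetz in

/-- for a Lefschetz endomorphism `ν` of degree 2 of a graded vector space,
every endomorphism `R` of degree `j + 2` (`j ≥ 0`) is a commutator `R = T∘ν − ν∘T`
with `T` of degree `j`. -/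
theorem stmt_1
    (k : Type*) [Field k] (V : Type*) [AddCommGroup V] [Module k V]
    [FiniteDimensional k V]
    (Vgr : ℤ → Submodule k V)
    (hinternal : DirectSum.IsInternal Vgr)
    (hfin : {a : ℤ | Vgr a ≠ ⊥}.Finite)
    (ν : V →ₗ[k] V)
    (hdeg : ∀ a : ℤ, ∀ x ∈ Vgr a, ν x ∈ Vgr (a + 2))
    (hLefInj : ∀ n : ℕ, ∀ x ∈ Vgr (-(n : ℤ)), (ν ^ n) x = 0 → x = 0)
    (hLefSurj : ∀ n : ℕ, ∀ y ∈ Vgr (n : ℤ), ∃ x ∈ Vgr (-(n : ℤ)), (ν ^ n) x = y)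
    (j : ℕ) (R : V →ₗ[k] V)
    (hR : ∀ a : ℤ, ∀ x ∈ Vgr a, R x ∈ Vgr (a + (j : ℤ) + 2)) :
    ∃ T : V →ₗ[k] V,
      (∀ a : ℤ, ∀ x ∈ Vgr a, T x ∈ Vgr (a + (j : ℤ))) ∧
      R = T ∘ₗ ν - ν ∘ₗ T := by
  let := hinternal.chooseDecomposition
  obtain ⟨B, hB⟩ : ∃ B : ℕ, ∀ a : ℤ, (B : ℤ) < |a| → Vgr a = ⊥ := by
    obtain ⟨B, hB⟩ := (hfin.image Int.natAbs).bddAbove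
    refine ⟨B, fun a ha => by_contra fun hne => ?_⟩
    have : a.natAbs ≤ B := hB ⟨a, hne, rfl⟩
    rw [Int.abs_eq_natAbs] at ha
    lia
  obtain ⟨T, hT⟩ := exists_eq_commutator ν R fun S hS => by
    refine (LinearMap.isNilpotent_trace_of_isNilpotent (isNilpotent_of_mapsTo_filtration
      hinternal.submodule_iSup_eq_top hB fun a x hx => ?_)).eq_zero
    exact filtration_antitone (by lia)
      (apply_mem_filtration_of_commute hB hdeg hLefInj hLefSurj hS (hR a x hx))
  refine ⟨degreePart Vgr j T, fun a x hx => ?_, LinearMap.ext fun x => ?_⟩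
  · rw [degreePart_apply T hx]
    exact SetLike.coe_mem _
  · induction x using DirectSum.Decomposition.inductionOn Vgr with
    | zero => simp
    | @homogeneous a m =>
      have hdeg_eq : a + (j : ℤ) + 2 = a + 2 + j := by ring
      have hRm : R m ∈ Vgr (a + 2 + j) := hdeg_eq ▸ hR a m m.2
      rw [LinearMap.sub_apply, LinearMap.comp_apply, LinearMap.comp_apply,
        degreePart_apply T (hdeg a m m.2), degreePart_apply T m.2, ← decompose_apply_add hdeg,
        hdeg_eq, ← DirectSum.decompose_of_mem_same Vgr hRm, hT]
      simp
    | add m m' hm hm' => rw [map_add, map_add, hm, hm']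
end

section
/- Let N be a nilpotent endomorphism of V. Then the subspaces V^N_{≥a} form a filtration of V (they are decreasing in a, equal to 0 for a sufficiently large and equal to V for a sufficiently small); moreover N(V^N_{≥a}) ⊆ V^N_{≥a+2} for every a, and for every n ≥ 0 the map gr_{−n} V^N_* → gr_n V^N_* induced by N^n is an isomorphism. -/
/-- The canonical (Dynkin–Kostant) filtration attached to a nilpotent endomorphism:
`V^N_{≥a} = Σ_{j ≥ max(0,a)} N^j (ker N^{2j−a+1})`. -/
noncomputable def canonFilt {k : Type*} [Field k] {V : Type*} [AddCommGroup V] [Module k V]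
    (N : V →ₗ[k] V) (a : ℤ) : Submodule k V :=
  ⨆ j : {j : ℕ // a ≤ (j : ℤ)},
    Submodule.map (N ^ (j : ℕ)) (LinearMap.ker (N ^ (2 * ((j : ℕ) : ℤ) - a + 1).toNat))

section

variable {k : Type*} [Field k] {V : Type*} [AddCommGroup V] [Module k V] {N : V →ₗ[k] V}

theorem pow_apply_mem_canonFilt {a : ℤ} {j : ℕ} (haj : a ≤ j) {z : V}
    (hz : (N ^ (2 * (j : ℤ) - a + 1).toNat) z = 0) : (N ^ j) z ∈ canonFilt N a :=
  Submodule.mem_iSup_of_mem (⟨j, haj⟩ : {j : ℕ // a ≤ (j : ℤ)})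
    (Submodule.mem_map_of_mem hz)

theorem canonFilt_le_iff {a : ℤ} {S : Submodule k V} :
    canonFilt N a ≤ S ↔
      ∀ j : ℕ, a ≤ j → ∀ z, (N ^ (2 * (j : ℤ) - a + 1).toNat) z = 0 → (N ^ j) z ∈ S := by
  simp only [canonFilt, iSup_le_iff, Submodule.map_le_iff_le_comap, Subtype.forall]
  rfl

theorem ker_pow_le_canonFilt {a : ℤ} {n : ℕ} (ha : a ≤ 0) (hn : (n : ℤ) ≤ 1 - a) :
    LinearMap.ker (N ^ n) ≤ canonFilt N a := fun z hz =>
  pow_apply_mem_canonFilt (j := 0) (by simpa using ha)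
    (Module.End.pow_map_zero_of_le (by omega) hz)

theorem canonFilt_antitone : Antitone (canonFilt N) := fun a b hab =>
  canonFilt_le_iff.2 fun _ hj _ hz =>
    pow_apply_mem_canonFilt (hab.trans hj) (Module.End.pow_map_zero_of_le (by omega) hz)

theorem canonFilt_le_comap (a : ℤ) : canonFilt N a ≤ (canonFilt N (a + 2)).comap N := by
  refine canonFilt_le_iff.2 fun j hj z hz => ?_
  rw [Submodule.mem_comap, ← Module.End.mul_apply, ← pow_succ']
  rcases hj.eq_or_lt with rfl | hj
  · rw [show (2 * (j : ℤ) - j + 1).toNat = j + 1 by omega] at hz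
    simp [hz]
  · exact pow_apply_mem_canonFilt (by omega) (Module.End.pow_map_zero_of_le (by omega) hz)

/-- For `n ≤ a`, every element of `canonFilt N a` is `N ^ n` of one of `canonFilt N (a - 2 * n)`. -/
theorem canonFilt_le_map_pow {a : ℤ} {n : ℕ} (hn : (n : ℤ) ≤ a) :
    canonFilt N a ≤ (canonFilt N (a - 2 * n)).map (N ^ n) := by
  refine canonFilt_le_iff.2 fun j hj z hz => ?_
  obtain ⟨i, rfl⟩ := Nat.exists_eq_add_of_le (show n ≤ j by omega)
  rw [pow_add, Module.End.mul_apply]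
  exact Submodule.mem_map_of_mem (pow_apply_mem_canonFilt (by omega)
    (Module.End.pow_map_zero_of_le (by omega) hz))

theorem canonFilt_eq_bot {m : ℕ} (hm : N ^ m = 0) {a : ℤ} (ha : (m : ℤ) ≤ a) :
    canonFilt N a = ⊥ :=
  eq_bot_iff.2 <| canonFilt_le_iff.2 fun j hj z _ => by
    simp [pow_eq_zero_of_le (show m ≤ j by omega) hm]

theorem canonFilt_eq_top {m : ℕ} (hm : N ^ m = 0) {a : ℤ} (ha : a ≤ -(m : ℤ)) :
    canonFilt N a = ⊤ :=
  eq_top_iff.2 fun z _ =>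
    ker_pow_le_canonFilt (n := m) (by omega) (by omega) (by simp [hm])

end

/-- the subspaces `V^N_{≥a}` form a filtration of `V`, `N` maps
`V^N_{≥a}` into `V^N_{≥a+2}`, and for every `n ≥ 0` the induced map
`gr_{−n} V^N_* → gr_n V^N_*` (induced by `N^n`) is an isomorphism (stated at the
level of elements: injectivity and surjectivity modulo the next filtration step). -/
theorem stmt_2
    (k : Type*) [Field k] (V : Type*) [AddCommGroup V] [Module k V]
    [FiniteDimensional k V]
    (N : V →ₗ[k] V) (hN : IsNilpotent N) :
    (∀ a : ℤ, canonFilt N (a + 1) ≤ canonFilt N a) ∧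
    (∃ a₀ : ℤ, ∀ a : ℤ, a₀ ≤ a → canonFilt N a = ⊥) ∧
    (∃ a₁ : ℤ, ∀ a : ℤ, a ≤ a₁ → canonFilt N a = ⊤) ∧
    (∀ a : ℤ, ∀ x ∈ canonFilt N a, N x ∈ canonFilt N (a + 2)) ∧
    (∀ n : ℕ,
      (∀ x ∈ canonFilt N (-(n : ℤ)), (N ^ n) x ∈ canonFilt N ((n : ℤ) + 1) →
        x ∈ canonFilt N (-(n : ℤ) + 1)) ∧
      (∀ y ∈ canonFilt N (n : ℤ), ∃ x ∈ canonFilt N (-(n : ℤ)),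
        (N ^ n) x - y ∈ canonFilt N ((n : ℤ) + 1))) := by
  obtain ⟨m, hm⟩ := hN
  refine ⟨fun a => canonFilt_antitone (by omega), ⟨m, fun a => canonFilt_eq_bot hm⟩,
    ⟨-m, fun a => canonFilt_eq_top hm⟩, fun a x hx => canonFilt_le_comap a hx,
    fun n => ⟨fun x _ hNx => ?_, fun y hy => ?_⟩⟩
  · rcases n.eq_zero_or_pos with rfl | hn
    · simpa using hNx
    obtain ⟨x', hx', hxx'⟩ := canonFilt_le_map_pow (n := n) (by omega) hNx
    rw [show (n : ℤ) + 1 - 2 * n = -n + 1 by ring] at hx'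
    have hker : x - x' ∈ canonFilt N (-(n : ℤ) + 1) :=
      ker_pow_le_canonFilt (n := n) (by omega) (by omega) (by simp [hxx'])
    simpa using add_mem hker hx'
  · obtain ⟨x, hx, rfl⟩ := canonFilt_le_map_pow (n := n) le_rfl hy
    rw [show (n : ℤ) - 2 * n = -n by ring] at hx
    exact ⟨x, hx, by simp⟩
end

section
/- Let N be a nilpotent endomorphism of V, let ν denote the degree-2 endomorphism of gr V^N_* induced by N, and for j ≥ 1 let P_{1−j} = {z ∈ gr_{1−j} V^N_* : ν^j z = 0} be the primitive subspace in degree 1−j. Then dim P_{1−j} = 2·dim ker(N^j) − dim ker(N^{j−1}) − dim ker(N^{j+1}); that is, dim P_{1−j} equals the number of Jordan blocks of size j of N acting on V. -/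
section

variable {k : Type*} [Field k] {V : Type*} [AddCommGroup V] [Module k V] (N : V →ₗ[k] V)

theorem map_ker_pow_le_canonFilt {a : ℤ} (i m : ℕ) (ha : a ≤ i) (hm : (m : ℤ) = 2 * i - a + 1) :
    Submodule.map (N ^ i) (LinearMap.ker (N ^ m)) ≤ canonFilt N a := by
  obtain rfl : m = (2 * (i : ℤ) - a + 1).toNat := by omega
  exact le_iSup (fun i : {i : ℕ // a ≤ (i : ℤ)} =>
    Submodule.map (N ^ (i : ℕ)) (LinearMap.ker (N ^ (2 * ((i : ℕ) : ℤ) - a + 1).toNat))) ⟨i, ha⟩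

theorem ker_pow_le_canonFilt_s3 (j : ℕ) (hj : 1 ≤ j) :
    LinearMap.ker (N ^ j) ≤ canonFilt N (1 - (j : ℤ)) := by
  simpa [Module.End.one_eq_id] using map_ker_pow_le_canonFilt N (a := 1 - (j : ℤ)) 0 j (by omega) (by omega)

theorem canonFilt_add_two_le_map (j : ℕ) :
    canonFilt N ((j : ℤ) + 2) ≤ Submodule.map (N ^ j) (canonFilt N (2 - (j : ℤ))) := by
  refine iSup_le ?_
  rintro ⟨i, hi⟩
  obtain ⟨l, rfl⟩ : ∃ l, i = j + l := ⟨i - j, by omega⟩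
  simp only [pow_add N j l, Module.End.mul_eq_comp, Submodule.map_comp]
  exact Submodule.map_mono (map_ker_pow_le_canonFilt N l _ (by omega) (by omega))

theorem map_ker_pow_succ (j : ℕ) :
    Submodule.map N (LinearMap.ker (N ^ (j + 1))) = LinearMap.range N ⊓ LinearMap.ker (N ^ j) := by
  ext x
  simp only [Submodule.mem_map, LinearMap.mem_ker, Submodule.mem_inf, LinearMap.mem_range, pow_succ,
    Module.End.mul_apply]
  constructor
  · rintro ⟨y, hy, rfl⟩
    exact ⟨⟨y, rfl⟩, hy⟩
  · rintro ⟨⟨y, rfl⟩, hy⟩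
    exact ⟨y, hy, rfl⟩

theorem ker_pow_le_ker_pow {i j : ℕ} (h : i ≤ j) :
    LinearMap.ker (N ^ i) ≤ LinearMap.ker (N ^ j) := by
  obtain ⟨l, rfl⟩ := Nat.exists_eq_add_of_le' h
  intro x hx
  simp_all [pow_add]

theorem ker_pow_inf_canonFilt (j : ℕ) (hj : 1 ≤ j) :
    LinearMap.ker (N ^ j) ⊓ canonFilt N (2 - (j : ℤ)) =
      LinearMap.ker (N ^ (j - 1)) ⊔ Submodule.map N (LinearMap.ker (N ^ (j + 1))) := by
  have hker : LinearMap.ker (N ^ (j - 1)) ≤ LinearMap.ker (N ^ j) :=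
    ker_pow_le_ker_pow N (Nat.sub_le j 1)
  apply le_antisymm
  · have hle : canonFilt N (2 - (j : ℤ)) ≤ LinearMap.ker (N ^ (j - 1)) ⊔ LinearMap.range N := by
      refine iSup_le ?_
      rintro ⟨i, hi⟩
      rcases i with _ | i
      · refine le_sup_of_le_left ?_
        rw [show (2 * ((0 : ℕ) : ℤ) - (2 - (j : ℤ)) + 1).toNat = j - 1 by omega]
        simp [Module.End.one_eq_id]
      · refine le_sup_of_le_right ?_
        rintro _ ⟨y, -, rfl⟩
        exact ⟨(N ^ i) y, by simp [pow_succ']⟩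
    rw [map_ker_pow_succ, ← sup_inf_assoc_of_le _ hker, inf_comm]
    exact inf_le_inf_right _ hle
  · refine sup_le (le_inf hker ?_) (le_inf ?_ ?_)
    · obtain rfl | hj' := hj.eq_or_lt
      · simp [Module.End.one_eq_id]
      · simpa [Module.End.one_eq_id] using
          map_ker_pow_le_canonFilt N (a := 2 - (j : ℤ)) 0 (j - 1) (by omega) (by omega)
    · exact (map_ker_pow_succ N j).trans_le inf_le_right
    · simpa using map_ker_pow_le_canonFilt N (a := 2 - (j : ℤ)) 1 (j + 1) (by omega) (by omega)

theorem finrank_map_ker_pow_succ [FiniteDimensional k V] (j : ℕ) :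
    Module.finrank k (Submodule.map N (LinearMap.ker (N ^ (j + 1)))) +
      Module.finrank k (LinearMap.ker N) = Module.finrank k (LinearMap.ker (N ^ (j + 1))) := by
  have hker : LinearMap.ker N ≤ LinearMap.ker (N ^ (j + 1)) := by
    simpa using ker_pow_le_ker_pow N (Nat.le_add_left 1 j)
  have h := LinearMap.finrank_range_add_finrank_ker (N.domRestrict (LinearMap.ker (N ^ (j + 1))))
  rwa [LinearMap.range_domRestrict, LinearMap.ker_domRestrict,
    (Submodule.comapSubtypeEquivOfLe hker).finrank_eq] at h

theorem finrank_ker_pow_sup_map_ker_pow [FiniteDimensional k V] (j : ℕ) (hj : 1 ≤ j) :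
    Module.finrank k ↥(LinearMap.ker (N ^ (j - 1)) ⊔ Submodule.map N (LinearMap.ker (N ^ (j + 1)))) +
      Module.finrank k (LinearMap.ker (N ^ j)) =
      Module.finrank k (LinearMap.ker (N ^ (j - 1))) +
        Module.finrank k (LinearMap.ker (N ^ (j + 1))) := by
  have hinf : LinearMap.ker (N ^ (j - 1)) ⊓ Submodule.map N (LinearMap.ker (N ^ (j + 1))) =
      Submodule.map N (LinearMap.ker (N ^ (j - 1 + 1))) := by
    rw [map_ker_pow_succ, map_ker_pow_succ, inf_left_comm,
      inf_eq_left.2 (ker_pow_le_ker_pow N (Nat.sub_le j 1))]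
  have h := Submodule.finrank_sup_add_finrank_inf_eq (LinearMap.ker (N ^ (j - 1)))
    (Submodule.map N (LinearMap.ker (N ^ (j + 1))))
  have hlower := finrank_map_ker_pow_succ N (j - 1)
  have hupper := finrank_map_ker_pow_succ N j
  rw [← hinf, Nat.sub_add_cancel hj] at hlower
  omega

end

theorem Submodule.finrank_quotient_comap_subtype_add_finrank_inf {k : Type*} [Field k]
    {V : Type*} [AddCommGroup V] [Module k V] [FiniteDimensional k V] {K S W : Submodule k V}
    (hKS : K ≤ S) (hS : S ≤ K ⊔ W) :
    Module.finrank k (S ⧸ Submodule.comap S.subtype W) + Module.finrank k ↥(K ⊓ W) =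
      Module.finrank k K := by
  let f : K →ₗ[k] S ⧸ Submodule.comap S.subtype W :=
    (Submodule.comap S.subtype W).mkQ ∘ₗ Submodule.inclusion hKS
  have hrange : LinearMap.range f = ⊤ := by
    rw [LinearMap.range_eq_top]
    intro q
    obtain ⟨⟨x, hx⟩, rfl⟩ := Submodule.mkQ_surjective _ q
    obtain ⟨y, hy, w, hw, rfl⟩ := Submodule.mem_sup.1 (hS hx)
    refine ⟨⟨y, hy⟩, (Submodule.Quotient.eq _).2 ?_⟩
    simpa using hw
  have hker : LinearMap.ker f = Submodule.comap K.subtype (K ⊓ W) := by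
    ext x
    simp [f]
  have h := LinearMap.finrank_range_add_finrank_ker f
  rwa [hrange, finrank_top, hker,
    (Submodule.comapSubtypeEquivOfLe inf_le_left).finrank_eq] at h

/-- the dimension of the primitive subspace
`P_{1−j} = {z ∈ gr_{1−j} V^N_* : ν^j z = 0}` equals
`2·dim ker N^j − dim ker N^{j−1} − dim ker N^{j+1}` (the number of Jordan blocks of
size `j`).  The primitive subspace is realized as the quotient
`S ⧸ V^N_{≥2−j}` where `S = {x ∈ V^N_{≥1−j} : N^j x ∈ V^N_{≥j+2}}` (the condition
`N^j x ∈ V^N_{≥j+2}` says exactly that `ν^j` kills the class of `x` in `gr_{1−j}`).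
The equality is stated additively to avoid truncated subtraction. -/
theorem stmt_3
    (k : Type*) [Field k] (V : Type*) [AddCommGroup V] [Module k V]
    [FiniteDimensional k V]
    (N : V →ₗ[k] V) (hN : IsNilpotent N)
    (j : ℕ) (hj : 1 ≤ j)
    (S : Submodule k V)
    (hS : S = canonFilt N (1 - (j : ℤ)) ⊓ Submodule.comap (N ^ j) (canonFilt N ((j : ℤ) + 2))) :
    Module.finrank k (S ⧸ Submodule.comap S.subtype (canonFilt N (2 - (j : ℤ))))
      + Module.finrank k (LinearMap.ker (N ^ (j - 1)))
      + Module.finrank k (LinearMap.ker (N ^ (j + 1)))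
      = 2 * Module.finrank k (LinearMap.ker (N ^ j)) := by
  have hK : LinearMap.ker (N ^ j) ≤ S := by
    rw [hS]
    refine le_inf (ker_pow_le_canonFilt_s3 N j hj) fun x hx => ?_
    rw [Submodule.mem_comap, LinearMap.mem_ker.1 hx]
    exact zero_mem _
  have hSle : S ≤ LinearMap.ker (N ^ j) ⊔ canonFilt N (2 - (j : ℤ)) := by
    rw [hS, sup_comm, ← Submodule.comap_map_eq]
    exact inf_le_right.trans (Submodule.comap_mono (canonFilt_add_two_le_map N j))
  have h := Submodule.finrank_quotient_comap_subtype_add_finrank_inf hK hSle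
  rw [ker_pow_inf_canonFilt N j hj] at h
  have hsup := finrank_ker_pow_sup_map_ker_pow N j hj
  omega
end

section
/- Let r ≥ 1 and let N be a nilpotent endomorphism of V with N^r = 0. If W and W' are r-special subspaces of V, then there exists a subspace X of V with N(X) ⊆ X such that V = W ⊕ X and V = W' ⊕ X. -/
/-- A subspace `W` of `V` is `r`-special (for a nilpotent `N` with `N^r = 0`):
`N(W) ⊆ W`, `N : W → W` has no Jordan block of size ≠ r
(equivalently `ker N ∩ W ⊆ N^{r−1}(W)`), and `N^{r−1}(V) ⊆ W`. -/
def IsSpecial {k : Type*} [Field k] {V : Type*} [AddCommGroup V] [Module k V]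
    (r : ℕ) (N : V →ₗ[k] V) (W : Submodule k V) : Prop :=
  (∀ x ∈ W, N x ∈ W) ∧
  LinearMap.ker N ⊓ W ≤ Submodule.map (N ^ (r - 1)) W ∧
  LinearMap.range (N ^ (r - 1)) ≤ W

/-- The largest `N`-stable subspace contained in the kernel of `φ`. -/
def stableKer {k : Type*} [Field k] {V : Type*} [AddCommGroup V] [Module k V]
    {S : Type*} [AddCommGroup S] [Module k S] (N : V →ₗ[k] V) (φ : V →ₗ[k] S) :
    Submodule k V :=
  ⨅ i : ℕ, LinearMap.ker (φ ∘ₗ N ^ i)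

section

variable {k : Type*} [Field k] {V : Type*} [AddCommGroup V] [Module k V]

theorem mem_stableKer {S : Type*} [AddCommGroup S] [Module k S] {N : V →ₗ[k] V}
    {φ : V →ₗ[k] S} {x : V} : x ∈ stableKer N φ ↔ ∀ i : ℕ, φ ((N ^ i) x) = 0 := by
  simp [stableKer]

theorem map_mem_stableKer {S : Type*} [AddCommGroup S] [Module k S] {N : V →ₗ[k] V}
    {φ : V →ₗ[k] S} {x : V} (hx : x ∈ stableKer N φ) : N x ∈ stableKer N φ := by
  rw [mem_stableKer] at hx ⊢
  intro i
  simpa [pow_succ] using hx (i + 1)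

theorem IsSpecial.pow_mem {r : ℕ} {N : V →ₗ[k] V} {W : Submodule k V} (hW : IsSpecial r N W)
    {x : V} (hx : x ∈ W) (i : ℕ) : (N ^ i) x ∈ W := by
  induction i with
  | zero => simpa using hx
  | succ i ih =>
    rw [pow_succ', Module.End.mul_apply]
    exact hW.1 _ ih

variable {r : ℕ} {N : V →ₗ[k] V} {W : Submodule k V}
  {φ : V →ₗ[k] LinearMap.range (N ^ (r - 1))}

theorem IsSpecial.disjoint_stableKer (hNr : N ^ r = 0) (hW : IsSpecial r N W)
    (hφ : ∀ s : LinearMap.range (N ^ (r - 1)), φ s = s) : Disjoint W (stableKer N φ) := by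
  rw [Submodule.disjoint_def]
  intro x hxW hxX
  rw [mem_stableKer] at hxX
  have key : ∀ i : ℕ, (N ^ i) x = 0 → x = 0 := by
    intro i
    induction i with
    | zero => simp
    | succ i ih =>
      intro h
      apply ih
      rw [pow_succ', Module.End.mul_apply] at h
      obtain ⟨w, -, hw⟩ := hW.2.1 ⟨LinearMap.mem_ker.2 h, hW.pow_mem hxW i⟩
      have h1 := hφ ⟨(N ^ i) x, w, hw⟩
      rw [hxX i] at h1
      exact (congrArg Subtype.val h1).symm
  exact key r (by simp [hNr])

theorem IsSpecial.codisjoint_stableKer (hr : 1 ≤ r) (hNr : N ^ r = 0) (hW : IsSpecial r N W)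
    (hφ : ∀ s : LinearMap.range (N ^ (r - 1)), φ s = s) : Codisjoint W (stableKer N φ) := by
  have hzero : ∀ i, r ≤ i → N ^ i = 0 := fun i hi => pow_eq_zero_of_le hi hNr
  rw [codisjoint_iff, Submodule.eq_top_iff']
  intro v
  have key : ∀ j ≤ r, ∃ w ∈ W, ∀ i, r - j ≤ i → φ ((N ^ i) (v - w)) = 0 := by
    intro j
    induction j with
    | zero =>
      exact fun _ => ⟨0, W.zero_mem, fun i hi => by simp [hzero i hi]⟩
    | succ j ih =>
      intro hj
      obtain ⟨w, hw, h⟩ := ih (by omega)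
      set s := φ ((N ^ (r - (j + 1))) (v - w))
      have hsker : N (s : V) = 0 := by
        obtain ⟨y, hy⟩ := s.2
        rw [← hy, ← Module.End.mul_apply, ← pow_succ', hzero _ (by omega), LinearMap.zero_apply]
      obtain ⟨y, hyW, hy⟩ := hW.2.1 ⟨LinearMap.mem_ker.2 hsker, hW.2.2 s.2⟩
      refine ⟨w + (N ^ j) y, W.add_mem hw (hW.pow_mem hyW j), fun i hi => ?_⟩
      rw [← sub_sub, map_sub, map_sub, ← Module.End.mul_apply, ← pow_add]
      rcases hi.eq_or_lt with rfl | hlt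
      · rw [show r - (j + 1) + j = r - 1 by omega, hy, hφ, sub_self]
      · have hy0 : (N ^ (i + j)) y = 0 := by rw [hzero _ (by omega), LinearMap.zero_apply]
        rw [h i (by omega), hy0, map_zero, sub_zero]
  obtain ⟨w, hw, h⟩ := key r le_rfl
  exact Submodule.mem_sup.2 ⟨w, hw, v - w, mem_stableKer.2 fun i => h i (by omega), by simp⟩

end

/-- two `r`-special subspaces admit a common `N`-stable complement. -/
theorem stmt_8
    (k : Type*) [Field k] (V : Type*) [AddCommGroup V] [Module k V]
    [FiniteDimensional k V]
    (r : ℕ) (hr : 1 ≤ r)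
    (N : V →ₗ[k] V) (hNr : N ^ r = 0)
    (W W' : Submodule k V)
    (hW : IsSpecial r N W) (hW' : IsSpecial r N W') :
    ∃ X : Submodule k V, (∀ x ∈ X, N x ∈ X) ∧ IsCompl W X ∧ IsCompl W' X := by
  obtain ⟨φ, hφ⟩ := LinearMap.exists_leftInverse_of_injective
    (LinearMap.range (N ^ (r - 1))).subtype (Submodule.ker_subtype _)
  have hφ' : ∀ s : LinearMap.range (N ^ (r - 1)), φ s = s := fun s => LinearMap.congr_fun hφ s
  exact ⟨stableKer N φ, fun _ hx => map_mem_stableKer hx,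
    ⟨hW.disjoint_stableKer hNr hφ', hW.codisjoint_stableKer hr hNr hφ'⟩,
    ⟨hW'.disjoint_stableKer hNr hφ', hW'.codisjoint_stableKer hr hNr hφ'⟩⟩
end

section
/- Let r ≥ 1 and let N be a nilpotent endomorphism of V with N^r = 0. If W and W' are r-special subspaces of V, then there exists an invertible linear automorphism g of V such that g(W) = W', gN = Ng, and g − 1 ∈ E_{≥1}V^N_*. -/
section

variable {k : Type*} [Field k] {V : Type*} [AddCommGroup V] [Module k V]
  {r : ℕ} {N : V →ₗ[k] V} {W : Submodule k V}

namespace IsSpecial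

lemma pow_mem_s9 (hW : IsSpecial r N W) (n : ℕ) {x : V} (hx : x ∈ W) : (N ^ n) x ∈ W := by
  induction n with
  | zero => simpa using hx
  | succ n ih =>
    rw [pow_succ', Module.End.mul_apply]
    exact hW.1 _ ih

/-- On an `r`-special subspace, the kernel of `N ^ m` is contained in the image of `N ^ (r - m)`. -/
lemma exists_pow_eq (hW : IsSpecial r N W) (m : ℕ) (hm : m ≤ r) {w : V} (hw : w ∈ W)
    (h0 : (N ^ m) w = 0) : ∃ u ∈ W, (N ^ (r - m)) u = w := by
  induction m generalizing w with
  | zero => exact ⟨0, W.zero_mem, by simpa using h0.symm⟩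
  | succ m ih =>
    have h1 : (N ^ m) w ∈ LinearMap.ker N ⊓ W := by
      refine ⟨?_, hW.pow_mem_s9 m hw⟩
      rw [SetLike.mem_coe, LinearMap.mem_ker, ← Module.End.mul_apply, ← pow_succ', h0]
    obtain ⟨u, hu, hu'⟩ := hW.2.1 h1
    have h2 : (N ^ m) (w - (N ^ (r - (m + 1))) u) = 0 := by
      rw [map_sub, ← Module.End.mul_apply, ← pow_add, ← hu',
        show m + (r - (m + 1)) = r - 1 by omega, sub_self]
    obtain ⟨v, hv, hv'⟩ := ih (by omega) (W.sub_mem hw (hW.pow_mem_s9 _ hu)) h2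
    refine ⟨N v + u, W.add_mem (hW.1 v hv) hu, ?_⟩
    rw [show r - m = (r - (m + 1)) + 1 by omega, pow_succ, Module.End.mul_apply] at hv'
    rw [map_add, hv', sub_add_cancel]

/-- An `r`-special subspace has an `N`-stable complement. -/
lemma exists_isCompl [FiniteDimensional k V] (hr : 1 ≤ r) (hNr : N ^ r = 0)
    (hW : IsSpecial r N W) : ∃ C : Submodule k V, (∀ x ∈ C, N x ∈ C) ∧ IsCompl W C := by
  obtain ⟨C, ⟨hCN, hCW⟩, hmax⟩ := WellFounded.has_min
    (wellFounded_gt (α := Submodule k V))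
    {C : Submodule k V | (∀ x ∈ C, N x ∈ C) ∧ Disjoint W C} ⟨⊥, by simp, disjoint_bot_right⟩
  refine ⟨C, hCN, hCW, ?_⟩
  have hCpow : ∀ n : ℕ, ∀ x ∈ C, (N ^ n) x ∈ C := fun n x hx ↦ by
    induction n with
    | zero => simpa using hx
    | succ n ih =>
      rw [pow_succ', Module.End.mul_apply]
      exact hCN _ ih
  have step : ∀ x, N x ∈ W ⊔ C → x ∈ W ⊔ C := by
    intro x hx
    by_contra hxn
    obtain ⟨w, hw, c, hc, hwc⟩ := Submodule.mem_sup.1 hx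
    have hsum : (N ^ (r - 1)) w + (N ^ (r - 1)) c = 0 := by
      rw [← map_add, hwc, ← Module.End.mul_apply, ← pow_succ, Nat.sub_add_cancel hr, hNr,
        LinearMap.zero_apply]
    have hw0 : (N ^ (r - 1)) w = 0 := by
      refine Submodule.disjoint_def.1 hCW _ (hW.pow_mem_s9 _ hw) ?_
      rw [eq_neg_of_add_eq_zero_left hsum]
      exact C.neg_mem (hCpow _ c hc)
    obtain ⟨u, hu, hu'⟩ := hW.exists_pow_eq (r - 1) (by omega) hw hw0
    rw [show r - (r - 1) = 1 by omega, pow_one] at hu'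
    have hNy : N (x - u) ∈ C := by
      rw [map_sub, hu', ← hwc, add_sub_cancel_left]
      exact hc
    have hy : x - u ∉ W ⊔ C := fun h ↦ hxn <| by
      simpa using (W ⊔ C).add_mem h (Submodule.mem_sup_left hu)
    refine hmax (C ⊔ k ∙ (x - u)) ⟨?_, ?_⟩ ?_
    · intro z hz
      obtain ⟨d, hd, _, ht, rfl⟩ := Submodule.mem_sup.1 hz
      obtain ⟨t, rfl⟩ := Submodule.mem_span_singleton.1 ht
      refine Submodule.mem_sup_left ?_
      rw [map_add, map_smul]
      exact C.add_mem (hCN d hd) (C.smul_mem _ hNy)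
    · rw [Submodule.disjoint_def]
      intro z hzW hz
      obtain ⟨d, hd, _, ht, rfl⟩ := Submodule.mem_sup.1 hz
      obtain ⟨t, rfl⟩ := Submodule.mem_span_singleton.1 ht
      rcases eq_or_ne t 0 with rfl | ht0
      · rw [zero_smul, add_zero] at hzW ⊢
        exact Submodule.disjoint_def.1 hCW _ hzW hd
      · refine absurd (((W ⊔ C).smul_mem_iff ht0).1 ?_) hy
        simpa using (W ⊔ C).sub_mem (Submodule.mem_sup_left hzW) (Submodule.mem_sup_right hd)
    · refine lt_of_le_of_ne le_sup_left fun h ↦ hy (Submodule.mem_sup_right ?_)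
      rw [h]
      exact Submodule.mem_sup_right (Submodule.mem_span_singleton_self _)
  have descend : ∀ n : ℕ, ∀ x, (N ^ n) x = 0 → x ∈ W ⊔ C := by
    intro n
    induction n with
    | zero =>
      intro x hx
      rw [pow_zero, Module.End.one_apply] at hx
      exact hx ▸ Submodule.zero_mem _
    | succ n ih => exact fun x hx ↦ step x (ih _ (by rwa [pow_succ] at hx))
  exact codisjoint_iff_le_sup.2 fun x _ ↦ descend r x (by rw [hNr, LinearMap.zero_apply])

/-- An `r`-special subspace is the image of a projection commuting with `N`. -/
lemma exists_projection [FiniteDimensional k V] (hr : 1 ≤ r) (hNr : N ^ r = 0)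
    (hW : IsSpecial r N W) :
    ∃ p : V →ₗ[k] V, Commute p N ∧ (∀ x, p x ∈ W) ∧ ∀ x ∈ W, p x = x := by
  obtain ⟨C, hCN, hC⟩ := hW.exists_isCompl hr hNr
  have hpW : ∀ x ∈ W, W.projection C hC x = x := fun _ hx ↦
    Submodule.projection_apply_of_mem_left hC hx
  have hpC : ∀ x ∈ C, W.projection C hC x = 0 := fun _ hx ↦
    (Submodule.projection_apply_eq_zero_iff hC).2 hx
  refine ⟨W.projection C hC, ?_, Submodule.projection_apply_mem hC, hpW⟩
  refine LinearMap.ext fun x ↦ ?_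
  have hx : x ∈ W ⊔ C := hC.sup_eq_top ▸ Submodule.mem_top
  obtain ⟨w, hw, c, hc, rfl⟩ := Submodule.mem_sup.1 hx
  simp only [Module.End.mul_apply, map_add]
  rw [hpW _ (hW.1 w hw), hpW w hw, hpC _ (hCN c hc), hpC c hc, map_zero]

end IsSpecial

lemma pow_mem_canonFilt {a : ℤ} {j : ℕ} (hj : a ≤ j) {n : ℕ} (hn : (n : ℤ) ≤ 2 * j - a + 1)
    {v : V} (hv : (N ^ n) v = 0) : (N ^ j) v ∈ canonFilt N a := by
  refine Submodule.mem_iSup_of_mem (⟨j, hj⟩ : {j : ℕ // a ≤ (j : ℤ)})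
    (Submodule.mem_map_of_mem ?_)
  exact Module.End.pow_map_zero_of_le (by dsimp only; omega) hv

/-- If `p` projects onto an `r`-special subspace, and `q` kills the image of `N ^ (r - 1)`, both
commuting with `N`, then `q ∘ p` raises the canonical filtration by one. -/
lemma IsSpecial.mul_apply_mem_canonFilt (hr : 1 ≤ r) (hNr : N ^ r = 0) (hW : IsSpecial r N W)
    {p q : V →ₗ[k] V} (hp : Commute p N) (hpW : ∀ x, p x ∈ W) (hq : Commute q N)
    (hq0 : q * N ^ (r - 1) = 0) {a : ℤ} {x : V} (hx : x ∈ canonFilt N a) :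
    q (p x) ∈ canonFilt N (a + 1) := by
  suffices canonFilt N a ≤ (canonFilt N (a + 1)).comap (q * p) from this hx
  refine iSup_le ?_
  rintro ⟨j, hj⟩
  rw [Submodule.map_le_iff_le_comap]
  intro v hv
  obtain ⟨m, hm⟩ : ∃ m : ℕ, 2 * (j : ℤ) - a + 1 = m := ⟨_, (Int.toNat_of_nonneg (by omega)).symm⟩
  simp only [hm, Int.toNat_natCast, LinearMap.mem_ker] at hv
  have comm : ∀ {f : V →ₗ[k] V}, Commute f N → ∀ (n : ℕ) (y : V), f ((N ^ n) y) = (N ^ n) (f y) :=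
    fun hf n y ↦ LinearMap.congr_fun (hf.pow_right n) y
  have hqN : ∀ y, (N ^ (r - 1)) (q y) = 0 := fun y ↦ by
    rw [← comm hq]
    exact LinearMap.congr_fun hq0 y
  change q (p ((N ^ j) v)) ∈ canonFilt N (a + 1)
  rw [comm hp, comm hq]
  obtain hjr | hjr := le_or_gt (r - 1) j
  · rw [Module.End.pow_map_zero_of_le hjr (hqN _)]
    exact Submodule.zero_mem _
  have hpv : (N ^ min m r) (p v) = 0 := by
    rcases min_choice m r with h | h
    · rw [h, ← comm hp, hv, map_zero]
    · rw [h, hNr, LinearMap.zero_apply]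
  obtain ⟨u, -, hu⟩ := hW.exists_pow_eq _ (min_le_right m r) (hpW v) hpv
  rw [← hu, comm hq, ← Module.End.mul_apply, ← pow_add]
  exact pow_mem_canonFilt (by omega) (by omega) (hqN u)

/-- An endomorphism commuting with a nilpotent `N` and injective on `ker N` is injective. -/
lemma injective_of_commute_of_ker (hNr : N ^ r = 0) {f : V →ₗ[k] V} (hf : Commute f N)
    (h : ∀ x, N x = 0 → f x = 0 → x = 0) : Function.Injective f := by
  rw [injective_iff_map_eq_zero]
  have key : ∀ n : ℕ, ∀ x, (N ^ n) x = 0 → f x = 0 → x = 0 := by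
    intro n
    induction n with
    | zero => exact fun x hx _ ↦ hx
    | succ n ih =>
      intro x hx hfx
      refine h x (ih _ (by rwa [pow_succ] at hx) ?_) hfx
      have := LinearMap.congr_fun hf x
      simp only [Module.End.mul_apply] at this
      rw [this, hfx, map_zero]
  exact fun x hx ↦ key r x (by rw [hNr, LinearMap.zero_apply]) hx

/-- Between two `r`-special subspaces there is an automorphism of `V` as required, with the
equality of the image of `W` with `W'` weakened to an inclusion. -/
lemma IsSpecial.exists_equiv_map_le [FiniteDimensional k V] (hr : 1 ≤ r) (hNr : N ^ r = 0)
    {W' : Submodule k V} (hW : IsSpecial r N W) (hW' : IsSpecial r N W') :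
    ∃ g : V ≃ₗ[k] V, W.map g.toLinearMap ≤ W' ∧ (∀ x : V, g (N x) = N (g x)) ∧
      ∀ a : ℤ, ∀ x ∈ canonFilt N a, g x - x ∈ canonFilt N (a + 1) := by
  obtain ⟨p, hpN, hpW, hp⟩ := hW.exists_projection hr hNr
  obtain ⟨p', hpN', hpW', hp'⟩ := hW'.exists_projection hr hNr
  have hqN : Commute (1 - p') N := (Commute.one_left N).sub_left hpN'
  have hq : ∀ x ∈ W', (1 - p' : V →ₗ[k] V) x = 0 := fun x hx ↦ by
    rw [LinearMap.sub_apply, Module.End.one_apply, hp' x hx, sub_self]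
  have hfN : Commute (1 - (1 - p') * p) N := (Commute.one_left N).sub_left (hqN.mul_left hpN)
  have hf : ∀ x, (1 - (1 - p') * p : V →ₗ[k] V) x = x - (1 - p' : V →ₗ[k] V) (p x) := fun x ↦ rfl
  have hinj : Function.Injective (1 - (1 - p') * p : V →ₗ[k] V) := by
    refine injective_of_commute_of_ker hNr hfN fun x hx hfx ↦ ?_
    have hpx : p x ∈ LinearMap.ker N ⊓ W := by
      refine ⟨?_, hpW x⟩
      have := LinearMap.congr_fun hpN x
      simp only [Module.End.mul_apply] at this
      rw [SetLike.mem_coe, LinearMap.mem_ker, ← this, hx, map_zero]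
    obtain ⟨u, -, hu⟩ := hW.2.1 hpx
    have hmem : p x ∈ W' := hu ▸ hW'.2.2 (LinearMap.mem_range_self _ u)
    rwa [hf, hq _ hmem, sub_zero] at hfx
  refine ⟨LinearEquiv.ofInjectiveEndo _ hinj, ?_, fun x ↦ LinearMap.congr_fun hfN x, ?_⟩
  · rintro _ ⟨w, hw, rfl⟩
    change (1 - (1 - p') * p : V →ₗ[k] V) w ∈ W'
    rw [hf, hp w hw, LinearMap.sub_apply, Module.End.one_apply, sub_sub_cancel]
    exact hpW' w
  · intro a x hx
    change (1 - (1 - p') * p : V →ₗ[k] V) x - x ∈ canonFilt N (a + 1)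
    rw [hf, sub_sub_cancel_left]
    refine Submodule.neg_mem _ (hW.mul_apply_mem_canonFilt hr hNr hpN hpW hqN ?_ hx)
    exact LinearMap.ext fun y ↦ hq _ (hW'.2.2 (LinearMap.mem_range_self _ y))

end

/-- two `r`-special subspaces are conjugate by an automorphism `g` of `V`
commuting with `N` and with `g − 1 ∈ E_{≥1}V^N_*`. -/
theorem stmt_9
    (k : Type*) [Field k] (V : Type*) [AddCommGroup V] [Module k V]
    [FiniteDimensional k V]
    (r : ℕ) (hr : 1 ≤ r)
    (N : V →ₗ[k] V) (hNr : N ^ r = 0)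
    (W W' : Submodule k V)
    (hW : IsSpecial r N W) (hW' : IsSpecial r N W') :
    ∃ g : V ≃ₗ[k] V,
      Submodule.map g.toLinearMap W = W' ∧
      (∀ x : V, g (N x) = N (g x)) ∧
      (∀ a : ℤ, ∀ x ∈ canonFilt N a, g x - x ∈ canonFilt N (a + 1)) := by
  obtain ⟨g, hg, hgN, hgF⟩ := hW.exists_equiv_map_le hr hNr hW'
  obtain ⟨g', hg', -⟩ := hW'.exists_equiv_map_le hr hNr hW
  refine ⟨g, Submodule.eq_of_le_of_finrank_le hg ?_, hgN, hgF⟩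
  have h := Submodule.finrank_mono hg'
  have e := LinearEquiv.finrank_map_eq g W
  have e' := LinearEquiv.finrank_map_eq g' W'
  exact (e'.symm.le.trans h).trans e.symm.le
end

section
/- For every natural number d there exists a polynomial P_d with integer coefficients, depending only on d, such that for every finite field F with q elements and every F-vector space W of dimension d, the number of nondegenerate symmetric bilinear forms W × W → F equals P_d(q). In particular this number is a polynomial in q with integer coefficients independent of the characteristic. -/
open Polynomial

namespace Matrix

variable {F ι m n : Type*}

/-- Adjoining a column to a matrix preserves the rank if the column lies in the column space, and
increases the rank by one otherwise. -/
theorem rank_fromCols_replicateCol [Field F] [Finite m] [Fintype n] (A : Matrix m n F) (v : m → F)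
    [Decidable (v ∈ A.mulVecLin.range)] :
    (fromCols A (replicateCol Unit v)).rank =
      if v ∈ A.mulVecLin.range then A.rank else A.rank + 1 := by
  have hrange : (fromCols A (replicateCol Unit v)).mulVecLin.range =
      A.mulVecLin.range ⊔ Submodule.span F {v} := by
    rw [range_mulVecLin, range_mulVecLin, ← Submodule.span_union]
    congr 1
    ext w
    simp [funext_iff, col_def, eq_comm, or_comm]
  rw [rank, hrange]
  split_ifs with hv
  · rw [sup_eq_left.2 (by simpa [Submodule.span_singleton_le_iff_mem] using hv), rank]
  · have hv0 : v ≠ 0 := by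
      rintro rfl
      exact hv (Submodule.zero_mem _)
    have hdisj : Disjoint A.mulVecLin.range (Submodule.span F {v}) :=
      (Submodule.disjoint_span_singleton' hv0).2 hv
    have h := Submodule.finrank_sup_add_finrank_inf_eq A.mulVecLin.range (Submodule.span F {v})
    rw [hdisj.eq_bot, finrank_bot, finrank_span_singleton hv0, add_zero] at h
    exact h

/-- The square matrix obtained from `B` by adjoining `v` both as a last row and as a last column,
with `a` as the new diagonal entry. -/
def bordered (B : Matrix ι ι F) (v : ι → F) (a : F) : Matrix (ι ⊕ Unit) (ι ⊕ Unit) F :=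
  fromBlocks B (replicateCol Unit v) (replicateRow Unit v) (of fun _ _ => a)

theorem bordered_eq_transpose_fromCols (B : Matrix ι ι F) (v : ι → F) (a : F) :
    B.bordered v a = (fromCols (fromCols B (replicateCol Unit v))ᵀ
      (replicateCol Unit (Sum.elim v fun _ => a)))ᵀ := by
  ext (i | i) (j | j) <;> simp [bordered]

theorem isSymm_bordered_iff {B : Matrix ι ι F} {v : ι → F} {a : F} :
    (B.bordered v a).IsSymm ↔ B.IsSymm := by
  rw [bordered, isSymm_fromBlocks_iff]
  simp [IsSymm, ← Matrix.ext_iff]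

theorem bordered_toBlocks₁₁ {M : Matrix (ι ⊕ Unit) (ι ⊕ Unit) F} (hM : M.IsSymm) :
    M.toBlocks₁₁.bordered (fun i => M (.inl i) (.inr ())) (M (.inr ()) (.inr ())) = M := by
  ext (i | i) (j | j) <;> simp [bordered, toBlocks₁₁, hM.apply]

/-- A symmetric matrix on `ι ⊕ Unit` is a symmetric matrix on `ι` together with a border. -/
def symmBorderedEquiv : {B : Matrix ι ι F // B.IsSymm} × (ι → F) × F ≃
    {M : Matrix (ι ⊕ Unit) (ι ⊕ Unit) F // M.IsSymm} where
  toFun p := ⟨p.1.1.bordered p.2.1 p.2.2, isSymm_bordered_iff.2 p.1.2⟩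
  invFun M := ⟨⟨M.1.toBlocks₁₁, M.2.submatrix Sum.inl⟩,
    fun i => M.1 (.inl i) (.inr ()), M.1 (.inr ()) (.inr ())⟩
  left_inv _ := rfl
  right_inv M := Subtype.ext (bordered_toBlocks₁₁ M.2)

variable [Field F] [Fintype ι]

theorem sumElim_mem_range_transpose_fromCols_iff {B : Matrix ι ι F} (hB : B.IsSymm)
    (x : ι → F) (a : F) :
    (Sum.elim (B *ᵥ x) fun _ : Unit => a) ∈
      (fromCols B (replicateCol Unit (B *ᵥ x)))ᵀ.mulVecLin.range ↔ a = x ⬝ᵥ B *ᵥ x := by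
  have hmul : ∀ y, (fromCols B (replicateCol Unit (B *ᵥ x)))ᵀ *ᵥ y =
      Sum.elim (B *ᵥ y) fun _ => x ⬝ᵥ B *ᵥ y := by
    intro y
    ext (i | i)
    · simp [transpose_fromCols, fromRows_mulVec, hB.eq]
    · change (B *ᵥ x) ⬝ᵥ y = x ⬝ᵥ B *ᵥ y
      rw [dotProduct_mulVec, ← mulVec_transpose, hB.eq]
  simp only [LinearMap.mem_range, mulVecLin_apply, hmul, Sum.elim_eq_iff]
  constructor
  · rintro ⟨y, hy, ha⟩
    rw [← hy]
    exact (congrFun ha ()).symm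
  · rintro rfl
    exact ⟨x, rfl, rfl⟩

theorem rank_bordered_of_notMem {B : Matrix ι ι F} (hB : B.IsSymm) {v : ι → F}
    (hv : v ∉ B.mulVecLin.range) (a : F) : (B.bordered v a).rank = B.rank + 2 := by
  classical
  rw [bordered_eq_transpose_fromCols, rank_transpose, rank_fromCols_replicateCol, if_neg,
    rank_transpose, rank_fromCols_replicateCol, if_neg hv]
  rintro ⟨y, hy⟩
  refine hv ⟨y, ?_⟩
  ext i
  simpa [transpose_fromCols, fromRows_mulVec, hB.eq] using congrFun hy (.inl i)

theorem rank_bordered_mulVec [DecidableEq F] {B : Matrix ι ι F} (hB : B.IsSymm) (x : ι → F)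
    (a : F) : (B.bordered (B *ᵥ x) a).rank =
      if a = x ⬝ᵥ B *ᵥ x then B.rank else B.rank + 1 := by
  classical
  rw [bordered_eq_transpose_fromCols, rank_transpose, rank_fromCols_replicateCol,
    rank_transpose, rank_fromCols_replicateCol,
    if_pos (show B *ᵥ x ∈ B.mulVecLin.range from ⟨x, rfl⟩)]
  simp only [sumElim_mem_range_transpose_fromCols_iff hB]

/-- The number, as a polynomial in the order of the field, of ways to border a symmetric matrix of
size `n` and rank `s` to a matrix of rank `r`. -/
noncomputable def borderPolynomial (n s r : ℕ) : ℤ[X] :=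
  if r = s then X ^ s
  else if r = s + 1 then X ^ s * (X - 1)
  else if r = s + 2 then (X ^ n - X ^ s) * X
  else 0

open Classical in
theorem card_rank_bordered_mulVec_eq [Fintype F] {B : Matrix ι ι F} (hB : B.IsSymm) (x : ι → F)
    (r : ℕ) : (Nat.card {a : F // (B.bordered (B *ᵥ x) a).rank = r} : ℤ) =
      if r = B.rank then 1 else if r = B.rank + 1 then (Fintype.card F : ℤ) - 1 else 0 := by
  simp only [rank_bordered_mulVec hB]
  rw [Nat.card_eq_fintype_card]
  split_ifs with h h'
  · subst h
    have : ∀ a, (if a = x ⬝ᵥ B *ᵥ x then B.rank else B.rank + 1) = B.rank ↔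
        a = x ⬝ᵥ B *ᵥ x := fun a => by split_ifs <;> simp_all
    simp [this]
  · subst h'
    have : ∀ a, (if a = x ⬝ᵥ B *ᵥ x then B.rank else B.rank + 1) = B.rank + 1 ↔
        ¬ a = x ⬝ᵥ B *ᵥ x := fun a => by split_ifs <;> simp_all
    simp only [this, Fintype.card_subtype_compl, Fintype.card_unique]
    rw [Nat.cast_sub Fintype.card_pos, Nat.cast_one]
  · have : ∀ a, ¬ (if a = x ⬝ᵥ B *ᵥ x then B.rank else B.rank + 1) = r :=
      fun a => by split_ifs <;> omega
    simp [this]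

theorem card_rank_bordered_eq [Fintype F] {B : Matrix ι ι F} (hB : B.IsSymm) (r : ℕ) :
    (Nat.card {p : (ι → F) × F // (B.bordered p.1 p.2).rank = r} : ℤ) =
      (borderPolynomial (Fintype.card ι) B.rank r).eval (Fintype.card F : ℤ) := by
  classical
  have hfiber : ∀ v : ι → F, (Nat.card {a : F // (B.bordered v a).rank = r} : ℤ) =
      if v ∈ B.mulVecLin.range then
        if r = B.rank then 1 else if r = B.rank + 1 then (Fintype.card F : ℤ) - 1 else 0
      else if r = B.rank + 2 then (Fintype.card F : ℤ) else 0 := by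
    intro v
    split_ifs with hv
    any_goals
      obtain ⟨x, rfl⟩ := hv
      simpa [*] using card_rank_bordered_mulVec_eq hB x r
    all_goals simp_all [rank_bordered_of_notMem hB hv, eq_comm]
  have hrange : (Finset.univ.filter (· ∈ B.mulVecLin.range)).card =
      Fintype.card F ^ B.rank := by
    rw [← Fintype.card_subtype, rank]
    exact Module.card_eq_pow_finrank (K := F) (V := B.mulVecLin.range)
  have hcompl := Finset.card_filter_add_card_filter_not (s := Finset.univ)
    (· ∈ B.mulVecLin.range)
  rw [hrange, Finset.card_univ, Fintype.card_fun] at hcompl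
  have hcompl' : ((Finset.univ.filter (· ∉ B.mulVecLin.range)).card : ℤ) =
      (Fintype.card F : ℤ) ^ Fintype.card ι - (Fintype.card F : ℤ) ^ B.rank := by
    rw [eq_sub_iff_add_eq']
    exact_mod_cast hcompl
  rw [Nat.card_congr (Equiv.subtypeProdEquivSigmaSubtype
    fun v a => (B.bordered v a).rank = r), Nat.card_sigma, Nat.cast_sum]
  simp only [hfiber]
  rw [Finset.sum_ite, Finset.sum_const, Finset.sum_const, nsmul_eq_mul, nsmul_eq_mul, hrange,
    hcompl', borderPolynomial]
  split_ifs <;> first | omega | simp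

/-- The number, as a polynomial in the order of the field, of symmetric matrices of size `n` and
rank `r`. -/
noncomputable def symmRankPolynomial : ℕ → ℕ → ℤ[X]
  | 0, r => if r = 0 then 1 else 0
  | n + 1, r => ∑ s ∈ Finset.range (n + 1), symmRankPolynomial n s * borderPolynomial n s r

theorem card_isSymm_rank_eq_sum [Fintype F] (r : ℕ) :
    (Nat.card {M : Matrix (ι ⊕ Unit) (ι ⊕ Unit) F // M.IsSymm ∧ M.rank = r} : ℤ) =
      ∑ s ∈ Finset.range (Fintype.card ι + 1),
        (Nat.card {B : Matrix ι ι F // B.IsSymm ∧ B.rank = s} : ℤ) *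
          (borderPolynomial (Fintype.card ι) s r).eval (Fintype.card F : ℤ) := by
  classical
  have e₁ : {M : Matrix (ι ⊕ Unit) (ι ⊕ Unit) F // M.IsSymm ∧ M.rank = r} ≃
      {M : {M : Matrix (ι ⊕ Unit) (ι ⊕ Unit) F // M.IsSymm} // M.1.rank = r} :=
    (Equiv.subtypeSubtypeEquivSubtypeInter IsSymm
      fun M : Matrix (ι ⊕ Unit) (ι ⊕ Unit) F => M.rank = r).symm
  have e₂ : {p : {B : Matrix ι ι F // B.IsSymm} × (ι → F) × F //
        (p.1.1.bordered p.2.1 p.2.2).rank = r} ≃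
      {M : {M : Matrix (ι ⊕ Unit) (ι ⊕ Unit) F // M.IsSymm} // M.1.rank = r} :=
    symmBorderedEquiv.subtypeEquiv fun _ => Iff.rfl
  have e₃ := Equiv.subtypeProdEquivSigmaSubtype
    fun (B : {B : Matrix ι ι F // B.IsSymm}) (p : (ι → F) × F) =>
      (B.1.bordered p.1 p.2).rank = r
  rw [Nat.card_congr (e₁.trans (e₂.symm.trans e₃)), Nat.card_sigma, Nat.cast_sum]
  simp only [fun B : {B : Matrix ι ι F // B.IsSymm} => card_rank_bordered_eq B.2 r]
  have hmaps : ∀ B ∈ (Finset.univ : Finset {B : Matrix ι ι F // B.IsSymm}),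
      B.1.rank ∈ Finset.range (Fintype.card ι + 1) :=
    fun B _ => Finset.mem_range_succ_iff.2 B.1.rank_le_card_width
  refine (Finset.sum_fiberwise_of_maps_to hmaps _).symm.trans
    (Finset.sum_congr rfl fun s _ => ?_)
  rw [Finset.sum_congr rfl fun B hB => by rw [(Finset.mem_filter.1 hB).2], Finset.sum_const,
    nsmul_eq_mul, ← Fintype.card_subtype, ← Nat.card_eq_fintype_card,
    Nat.card_congr (Equiv.subtypeSubtypeEquivSubtypeInter _ fun B : Matrix ι ι F => B.rank = s)]

theorem card_isSymm_rank_congr {κ : Type*} [Fintype κ] (e : ι ≃ κ) (r : ℕ) :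
    Nat.card {M : Matrix ι ι F // M.IsSymm ∧ M.rank = r} =
      Nat.card {M : Matrix κ κ F // M.IsSymm ∧ M.rank = r} :=
  Nat.card_congr <| (reindex e e).subtypeEquiv fun M => by
    rw [isSymm_reindex_iff, rank_reindex]

theorem card_isSymm_rank_eq [Fintype F] (n r : ℕ) :
    (Nat.card {M : Matrix (Fin n) (Fin n) F // M.IsSymm ∧ M.rank = r} : ℤ) =
      (symmRankPolynomial n r).eval (Fintype.card F : ℤ) := by
  induction n generalizing r with
  | zero =>
    have hsymm : ∀ M : Matrix (Fin 0) (Fin 0) F, M.IsSymm := fun M => Subsingleton.elim _ _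
    have hrank : ∀ M : Matrix (Fin 0) (Fin 0) F, M.rank = 0 := fun M => by
      simpa using M.rank_le_card_width
    by_cases hr : r = 0 <;>
      simp [-Nat.card_eq_fintype_card, symmRankPolynomial, hsymm, hrank, hr, eq_comm]
  | succ n ih =>
    rw [card_isSymm_rank_congr (Fintype.equivOfCardEq (by simp) : Fin (n + 1) ≃ Fin n ⊕ Unit),
      card_isSymm_rank_eq_sum]
    simp [symmRankPolynomial, eval_finsetSum, ih]

theorem rank_eq_card_iff_det_ne_zero [DecidableEq ι] (M : Matrix ι ι F) :
    M.rank = Fintype.card ι ↔ M.det ≠ 0 := by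
  refine ⟨fun h => ?_, rank_of_det_ne_zero⟩
  have hsurj : Function.Surjective M.mulVec := LinearMap.range_eq_top.1
    (Submodule.eq_top_of_finrank_eq (h.trans (Module.finrank_fintype_fun_eq_card F).symm) :
      M.mulVecLin.range = ⊤)
  exact ((isUnit_iff_isUnit_det M).1 (mulVec_surjective_iff_isUnit.1 hsurj)).ne_zero

end Matrix

theorem LinearMap.card_symm_separatingLeft {F W ι : Type*} [Field F] [AddCommGroup W] [Module F W]
    [Fintype ι] (b : Module.Basis ι F W) :
    Nat.card {B : W →ₗ[F] W →ₗ[F] F // (∀ x y, B x y = B y x) ∧ B.SeparatingLeft} =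
      Nat.card {M : Matrix ι ι F // M.IsSymm ∧ M.rank = Fintype.card ι} := by
  classical
  refine Nat.card_congr ((LinearMap.toMatrix₂ b b).toEquiv.subtypeEquiv fun B => and_congr ?_ ?_)
  · exact (LinearMap.BilinForm.isSymm_def (B := B)).symm.trans
      (LinearMap.BilinForm.isSymm_toMatrix_iff_isSymm b).symm
  · rw [Matrix.rank_eq_card_iff_det_ne_zero]
    exact LinearMap.separatingLeft_iff_det_ne_zero b

/-- for each `d` there is a polynomial `P_d ∈ ℤ[X]`, depending only on
`d`, such that for every finite field `F` with `q` elements and every `d`-dimensional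
`F`-vector space `W`, the number of nondegenerate symmetric bilinear forms on `W`
equals `P_d(q)`. -/
theorem stmt_11 (d : ℕ) :
    ∃ P : Polynomial ℤ,
      ∀ (F : Type) [Field F] [Fintype F]
        (W : Type) [AddCommGroup W] [Module F W] [FiniteDimensional F W],
        Module.finrank F W = d →
        (Nat.card {b : W →ₗ[F] W →ₗ[F] F //
            (∀ x y : W, b x y = b y x) ∧ (∀ x : W, (∀ y : W, b x y = 0) → x = 0)} : ℤ)
          = P.eval (Fintype.card F : ℤ) := by
  refine ⟨Matrix.symmRankPolynomial d d, fun F _ _ W _ _ _ hd => ?_⟩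
  rw [← Matrix.card_isSymm_rank_eq]
  have h := LinearMap.card_symm_separatingLeft (Module.finBasisOfFinrankEq F W hd)
  rw [Fintype.card_fin] at h
  exact congrArg Nat.cast h
end

section
/- Let ⟨,⟩ be a symplectic form on V and let N be a nilpotent endomorphism of V with 1+N ∈ Sp(⟨,⟩), i.e. ⟨Nx,y⟩ + ⟨x,Ny⟩ + ⟨Nx,Ny⟩ = 0 for all x,y ∈ V. Then the canonical filtration V^N_* is self-dual: for every a ∈ ℤ, the orthogonal complement of V^N_{≥a} with respect to ⟨,⟩ equals V^N_{≥1−a}. -/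
section CanonicalFiltration

variable {k : Type*} [Field k] {V : Type*} [AddCommGroup V] [Module k V]

theorem pow_apply_mem_canonFilt_s12 {N : V →ₗ[k] V} {a : ℤ} {j m : ℕ} (hj : a ≤ j)
    (hm : (m : ℤ) = 2 * j - a + 1) {v : V} (hv : (N ^ m) v = 0) :
    (N ^ j) v ∈ canonFilt N a := by
  have hm' : (2 * (j : ℤ) - a + 1).toNat = m := by omega
  refine Submodule.mem_iSup_of_mem (⟨j, hj⟩ : {j : ℕ // a ≤ (j : ℤ)}) ?_
  exact Submodule.mem_map_of_mem (by simpa [hm'] using hv)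

theorem canonFilt_le {N : V →ₗ[k] V} {a : ℤ} {W : Submodule k V}
    (h : ∀ j m : ℕ, a ≤ j → (m : ℤ) = 2 * j - a + 1 → ∀ v, (N ^ m) v = 0 → (N ^ j) v ∈ W) :
    canonFilt N a ≤ W := by
  refine iSup_le ?_
  rintro ⟨j, hj⟩
  rintro _ ⟨v, hv, rfl⟩
  exact h j _ hj (by push_cast; omega) v hv

variable {B : V →ₗ[k] V →ₗ[k] k} {N : V →ₗ[k] V}

/-- Up to sign and the unipotent operator `1 + N`, the endomorphism `N` is self-adjoint. -/
theorem apply_pow_left_eq (hsp : ∀ x y : V, B (N x) y + B x (N y) + B (N x) (N y) = 0)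
    (m : ℕ) (x y : V) :
    B ((N ^ m) x) y = (-1) ^ m * B (((1 + N) ^ m) x) ((N ^ m) y) := by
  induction m generalizing x y with
  | zero => simp
  | succ m ih =>
    have h := hsp (((1 + N) ^ m) x) ((N ^ m) y)
    have hc : ((1 + N) ^ m) (N x) = N (((1 + N) ^ m) x) := by
      have : Commute ((1 + N) ^ m) N :=
        ((Commute.one_left N).add_left (Commute.refl N)).pow_left m
      exact LinearMap.congr_fun this.eq x
    rw [pow_succ N, Module.End.mul_apply, ih, hc, ← pow_succ N, pow_succ' N, pow_succ' (1 + N),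
      Module.End.mul_apply, Module.End.mul_apply, LinearMap.add_apply, Module.End.one_apply,
      map_add, LinearMap.add_apply, pow_succ]
    linear_combination (-1) ^ m * h

theorem one_add_pow_bijective (hN : IsNilpotent N) (m : ℕ) :
    Function.Bijective ((1 + N) ^ m : V →ₗ[k] V) :=
  (Module.End.isUnit_iff _).1 (hN.isUnit_one_add.pow m)

theorem apply_eq_zero_of_mem_canonFilt (halt : B.IsAlt)
    (hsp : ∀ x y : V, B (N x) y + B x (N y) + B (N x) (N y) = 0) {a : ℤ} {x w : V}
    (hx : x ∈ canonFilt N (1 - a)) (hw : w ∈ canonFilt N a) : B x w = 0 := by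
  have key : ∀ i j m : ℕ, m ≤ i + j → ∀ u v : V, (N ^ m) v = 0 →
      B ((N ^ i) u) ((N ^ j) v) = 0 := by
    intro i j m hm u v hv
    have h : (N ^ i) ((N ^ j) v) = 0 := by
      rw [← Module.End.mul_apply, ← pow_add]
      exact Module.End.pow_map_zero_of_le hm hv
    rw [apply_pow_left_eq hsp, h, map_zero, mul_zero]
  suffices h : canonFilt N (1 - a) ≤ LinearMap.ker (B.flip w) by
    simpa using h hx
  refine canonFilt_le fun i n hi hn u hu => ?_
  suffices h : canonFilt N a ≤ LinearMap.ker (B ((N ^ i) u)) by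
    simpa using h hw
  refine canonFilt_le fun j m hj hm v hv => ?_
  rw [LinearMap.mem_ker]
  by_cases hij : m ≤ i + j
  · exact key i j m hij u v hv
  · rw [← halt.neg, key j i n (by omega) v u hu, neg_zero]

variable [FiniteDimensional k V]

/-- The orthogonal of `ker N ^ m` is contained in the range of `N ^ m`. -/
theorem mem_range_pow_of_orthogonal_ker (halt : B.IsAlt)
    (hnd : ∀ x : V, (∀ y : V, B x y = 0) → x = 0) (hN : IsNilpotent N)
    (hsp : ∀ x y : V, B (N x) y + B x (N y) + B (N x) (N y) = 0) {m : ℕ} {y : V}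
    (hy : ∀ v, (N ^ m) v = 0 → B v y = 0) : y ∈ LinearMap.range (N ^ m) := by
  have hB : LinearMap.BilinForm.Nondegenerate B :=
    (halt.isRefl.nondegenerate_iff_separatingLeft).2 hnd
  rw [← LinearMap.BilinForm.orthogonal_orthogonal hB halt.isRefl (LinearMap.range (N ^ m)),
    LinearMap.BilinForm.mem_orthogonal_iff]
  intro v hv
  refine hy v (hnd _ fun z => ?_)
  obtain ⟨u, rfl⟩ := (one_add_pow_bijective hN m).2 z
  have h : B ((N ^ m) u) v = 0 := hv _ (LinearMap.mem_range_self _ u)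
  rw [apply_pow_left_eq hsp] at h
  rw [← halt.neg, neg_eq_zero]
  exact (mul_eq_zero.1 h).resolve_left (pow_ne_zero _ (neg_ne_zero.2 one_ne_zero))

theorem pow_apply_mem_range_of_orthogonal (halt : B.IsAlt)
    (hnd : ∀ x : V, (∀ y : V, B x y = 0) → x = 0) (hN : IsNilpotent N)
    (hsp : ∀ x y : V, B (N x) y + B x (N y) + B (N x) (N y) = 0) {a : ℤ} {x : V}
    (hx : ∀ w ∈ canonFilt N a, B x w = 0) {j m : ℕ} (hj : a ≤ j)
    (hm : (m : ℤ) = 2 * j - a + 1) : (N ^ j) x ∈ LinearMap.range (N ^ m) := by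
  refine mem_range_pow_of_orthogonal_ker halt hnd hN hsp fun v hv => ?_
  obtain ⟨v, rfl⟩ := (one_add_pow_bijective hN j).2 v
  have hc : Commute (N ^ m) ((1 + N) ^ j) :=
    ((Commute.one_right N).add_right (Commute.refl N)).pow_pow m j
  rw [← Module.End.mul_apply, hc.eq, Module.End.mul_apply] at hv
  have hv' : (N ^ m) v = 0 := (one_add_pow_bijective hN j).1 (by rw [hv, map_zero])
  have h := hx _ (pow_apply_mem_canonFilt_s12 hj hm hv')
  rw [← halt.neg, neg_eq_zero, apply_pow_left_eq hsp] at h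
  exact (mul_eq_zero.1 h).resolve_left (pow_ne_zero _ (neg_ne_zero.2 one_ne_zero))

theorem mem_canonFilt_of_orthogonal (halt : B.IsAlt)
    (hnd : ∀ x : V, (∀ y : V, B x y = 0) → x = 0) (hN : IsNilpotent N)
    (hsp : ∀ x y : V, B (N x) y + B x (N y) + B (N x) (N y) = 0) {a : ℤ} {x : V}
    (hx : ∀ w ∈ canonFilt N a, B x w = 0) : x ∈ canonFilt N (1 - a) := by
  have approx : ∀ n : ℕ, ∃ t, x - (N ^ ((1 - a).toNat + n)) t ∈ canonFilt N (1 - a) := by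
    intro n
    induction n with
    | zero =>
      rcases le_or_gt a 0 with ha | ha
      · obtain ⟨t, ht⟩ := pow_apply_mem_range_of_orthogonal halt hnd hN hsp hx (j := 0)
          (m := (1 - a).toNat) (by simpa using ha) (by push_cast; omega)
        exact ⟨t, by simp [ht]⟩
      · have h0 : (1 - a).toNat = 0 := by omega
        exact ⟨x, by simp [h0]⟩
    | succ n ih =>
      obtain ⟨t, ht⟩ := ih
      set i := (1 - a).toNat + n with hi
      obtain ⟨j, hj⟩ : ∃ j : ℕ, (j : ℤ) = i + a := ⟨(i + a).toNat, by omega⟩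
      have hy : ∀ w ∈ canonFilt N a, B ((N ^ i) t) w = 0 := fun w hw => by
        have h := apply_eq_zero_of_mem_canonFilt halt hsp ht hw
        simpa [hx w hw] using h
      obtain ⟨t', ht'⟩ := pow_apply_mem_range_of_orthogonal halt hnd hN hsp hy (j := j)
        (m := j + i + 1) (by omega) (by push_cast; omega)
      refine ⟨t', ?_⟩
      have hmem : (N ^ i) (t - N t') ∈ canonFilt N (1 - a) := by
        refine pow_apply_mem_canonFilt_s12 (m := j + i) (by omega) (by push_cast; omega) ?_
        rw [map_sub, sub_eq_zero, ← Module.End.mul_apply, ← pow_succ, ht', pow_add,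
          Module.End.mul_apply]
      have h := add_mem ht hmem
      rwa [map_sub, ← Module.End.mul_apply, ← pow_succ, sub_add_sub_cancel] at h
  obtain ⟨n, hn⟩ := hN
  obtain ⟨t, ht⟩ := approx n
  simpa [pow_add, hn] using ht

end CanonicalFiltration

/-- if `⟨,⟩` is a symplectic form on `V` and `N` is nilpotent with
`1 + N ∈ Sp(⟨,⟩)`, then the canonical filtration `V^N_*` is self-dual:
`(V^N_{≥a})^⊥ = V^N_{≥1−a}` for all `a`. -/
theorem stmt_12
    (k : Type*) [Field k] (V : Type*) [AddCommGroup V] [Module k V]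
    [FiniteDimensional k V]
    (B : V →ₗ[k] V →ₗ[k] k)
    (halt : ∀ x : V, B x x = 0)
    (hnd : ∀ x : V, (∀ y : V, B x y = 0) → x = 0)
    (N : V →ₗ[k] V) (hN : IsNilpotent N)
    (hsp : ∀ x y : V, B (N x) y + B x (N y) + B (N x) (N y) = 0) :
    ∀ a : ℤ, ∀ x : V, (∀ w ∈ canonFilt N a, B x w = 0) ↔ x ∈ canonFilt N (1 - a) := by
  exact fun a x => ⟨fun hx => mem_canonFilt_of_orthogonal halt hnd hN hsp hx,
    fun hx w hw => apply_eq_zero_of_mem_canonFilt halt hsp hx hw⟩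
end

section
/- Let ⟨,⟩ be a symplectic form on V and let N be a nilpotent endomorphism of V with 1+N ∈ Sp(⟨,⟩), i.e. ⟨Nx,y⟩ + ⟨x,Ny⟩ + ⟨Nx,Ny⟩ = 0 for all x,y ∈ V. Then for all integers a, a' with a + a' + 2 = 0 and all x ∈ V^N_{≥a'}, y ∈ V^N_{≥a}, one has ⟨Nx,y⟩ + ⟨x,Ny⟩ = 0. (Thus the endomorphism of gr V^N_* induced by N is skew-adjoint with respect to the symplectic form induced on gr V^N_*.) -/
/-- If `B (N x) y + B x (N y) + B (N x) (N y) = 0` and `N ^ m` kills `v`, then `N ^ s u` is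
orthogonal to `N ^ t v` as soon as `m ≤ s + t`. -/
theorem pairing_pow_eq_zero_of_pow_right_eq_zero
    {k : Type*} [Field k] {V : Type*} [AddCommGroup V] [Module k V]
    (B : V →ₗ[k] V →ₗ[k] k) (N : V →ₗ[k] V)
    (hsp : ∀ x y : V, B (N x) y + B x (N y) + B (N x) (N y) = 0)
    {m : ℕ} {v : V} (hv : (N ^ m) v = 0) (u : V) (s t : ℕ) (hst : m ≤ s + t) :
    B ((N ^ s) u) ((N ^ t) v) = 0 := by
  induction hd : m - t generalizing s t with
  | zero =>
    rw [Module.End.pow_map_zero_of_le (by omega) hv, map_zero]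
  | succ d ih =>
    obtain ⟨r, rfl⟩ : ∃ r, s = r + 1 := ⟨s - 1, by omega⟩
    have hshift := ih r (t + 1) (by omega) (by omega)
    have hboth := ih (r + 1) (t + 1) (by omega) (by omega)
    have h := hsp ((N ^ r) u) ((N ^ t) v)
    simp only [pow_succ', Module.End.mul_apply] at hshift hboth ⊢
    rwa [hshift, hboth, add_zero, add_zero] at h

/-- The pairing of `N x` and `N y` vanishes for `x ∈ V^N_{≥a'}`, `y ∈ V^N_{≥a}` with
`a + a' + 2 = 0`. -/
theorem pairing_map_map_eq_zero_of_mem_canonFilt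
    {k : Type*} [Field k] {V : Type*} [AddCommGroup V] [Module k V]
    (B : V →ₗ[k] V →ₗ[k] k) (N : V →ₗ[k] V)
    (hsp : ∀ x y : V, B (N x) y + B x (N y) + B (N x) (N y) = 0)
    {a a' : ℤ} (haa' : a + a' + 2 = 0) {x y : V}
    (hx : x ∈ canonFilt N a') (hy : y ∈ canonFilt N a) :
    B (N x) (N y) = 0 := by
  unfold canonFilt at hx hy
  induction hx using Submodule.iSup_induction' with
  | zero => simp
  | add x₁ x₂ _ _ h₁ h₂ => simp [h₁, h₂]
  | mem i x hx =>
    induction hy using Submodule.iSup_induction' with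
    | zero => simp
    | add y₁ y₂ _ _ h₁ h₂ => simp [h₁, h₂]
    | mem j y hy =>
      obtain ⟨i, hi⟩ := i
      obtain ⟨j, hj⟩ := j
      obtain ⟨u, hu, rfl⟩ := hx
      obtain ⟨v, hv, rfl⟩ := hy
      rw [SetLike.mem_coe, LinearMap.mem_ker] at hu hv
      simp only [← Module.End.mul_apply, ← pow_succ']
      by_cases hij : 2 * (j : ℤ) - a + 1 ≤ i + j + 2
      · exact pairing_pow_eq_zero_of_pow_right_eq_zero B N hsp hv u (i + 1) (j + 1)
          (by dsimp only; omega)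
      · refine pairing_pow_eq_zero_of_pow_right_eq_zero B.flip N (fun x y => ?_) hu v
          (j + 1) (i + 1) (by dsimp only; omega)
        simp only [LinearMap.flip_apply]
        rw [add_comm (B y (N x))]
        exact hsp y x

/-- with `⟨,⟩` symplectic and `1 + N ∈ Sp(⟨,⟩)`, for `a + a' + 2 = 0`,
`x ∈ V^N_{≥a'}` and `y ∈ V^N_{≥a}` one has `⟨Nx,y⟩ + ⟨x,Ny⟩ = 0` (the endomorphism of
`gr V^N_*` induced by `N` is skew-adjoint for the induced symplectic form). -/
theorem stmt_13
    (k : Type*) [Field k] (V : Type*) [AddCommGroup V] [Module k V]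
    [FiniteDimensional k V]
    (B : V →ₗ[k] V →ₗ[k] k)
    (halt : ∀ x : V, B x x = 0)
    (hnd : ∀ x : V, (∀ y : V, B x y = 0) → x = 0)
    (N : V →ₗ[k] V) (hN : IsNilpotent N)
    (hsp : ∀ x y : V, B (N x) y + B x (N y) + B (N x) (N y) = 0) :
    ∀ a a' : ℤ, a + a' + 2 = 0 →
      ∀ x ∈ canonFilt N a', ∀ y ∈ canonFilt N a,
        B (N x) y + B x (N y) = 0 := by
  intro a a' haa' x hx y hy
  have h := hsp x y
  rwa [pairing_map_map_eq_zero_of_mem_canonFilt B N hsp haa' hx hy, add_zero] at h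
end

section
/- Assume char k = 2. Let ⟨,⟩ be a symplectic form on V and let N be a nilpotent endomorphism of V with 1+N ∈ Sp(⟨,⟩). Let n ≥ 2 be an even integer and suppose that ⟨v, N^{n−1}v⟩ = 0 for every v ∈ V^N_{≥1−n} with N^{n+1}v = 0. Then for any x, x' ∈ V^N_{≥−n} with N^{n+1}x = 0, N^{n+1}x' = 0 and x − x' ∈ V^N_{≥1−n}, one has ⟨x, N^{n−1}x⟩ = ⟨x', N^{n−1}x'⟩. (Hence the quadratic form q_n attached to (N,⟨,⟩) on the primitive part in degree −n of gr V^N_* is well defined.) -/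
section SymplecticUnipotent

variable {k : Type*} [Field k] {V : Type*} [AddCommGroup V] [Module k V]

/-- `y = (1 + N)⁻¹ w` satisfies every equation `N ^ a y = 0` that `w` satisfies. -/
theorem exists_add_apply_eq_of_isNilpotent {N : V →ₗ[k] V} (hN : IsNilpotent N) (w : V) :
    ∃ y, w = y + N y ∧ ∀ a : ℕ, (N ^ a) w = 0 → (N ^ a) y = 0 := by
  obtain ⟨g, hg⟩ := hN.isUnit_one_add
  have hgy (z : V) : (g : V →ₗ[k] V) ((↑g⁻¹ : V →ₗ[k] V) z) = z := by
    rw [← Module.End.mul_apply, Units.mul_inv, Module.End.one_apply]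
  refine ⟨(↑g⁻¹ : V →ₗ[k] V) w, ?_, fun a ha => ?_⟩
  · conv_lhs => rw [← hgy w, hg]
    simp
  · have hc : Commute (N ^ a) (↑g⁻¹ : V →ₗ[k] V) := by
      refine Commute.units_inv_right ?_
      rw [hg]
      exact (Commute.one_right _).add_right ((Commute.refl N).pow_left a)
    rw [← Module.End.mul_apply, hc.eq, Module.End.mul_apply, ha, map_zero]

variable {B : V →ₗ[k] V →ₗ[k] k} {N : V →ₗ[k] V}

/-- The range of `N ^ a` is orthogonal to the kernel of `N ^ a`. -/
theorem apply_pow_eq_zero_of_pow_apply_eq_zero (hN : IsNilpotent N)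
    (hsp : ∀ x y : V, B (N x) y + B x (N y) + B (N x) (N y) = 0)
    (a : ℕ) (u w : V) (hw : (N ^ a) w = 0) : B ((N ^ a) u) w = 0 := by
  induction a generalizing w with
  | zero => simp_all
  | succ a ih =>
    obtain ⟨y, hy, hker⟩ := exists_add_apply_eq_of_isNilpotent hN w
    have h0 := ih (N y) (by simpa [pow_succ] using hker _ hw)
    have h1 := hsp ((N ^ a) u) y
    rw [pow_succ', Module.End.mul_apply, hy, map_add]
    linear_combination h1 - h0

/-- Moving `N ^ m` across the form, when `N ^ (m + 2)` kills the other argument. -/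
theorem apply_pow_left_eq_of_pow_add_two [CharP k 2] (hN : IsNilpotent N)
    (hsp : ∀ x y : V, B (N x) y + B x (N y) + B (N x) (N y) = 0)
    (m : ℕ) (x v : V) (hv : (N ^ (m + 2)) v = 0) :
    B ((N ^ m) x) v = B x ((N ^ m) v) + m * B x ((N ^ (m + 1)) v) := by
  induction m generalizing v with
  | zero => simp
  | succ m ih =>
    obtain ⟨y, hy, hker⟩ := exists_add_apply_eq_of_isNilpotent hN v
    have hpow (j : ℕ) : (N ^ j) (N y) = (N ^ (j + 1)) y := by
      rw [pow_succ, Module.End.mul_apply]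
    have hy0 : (N ^ (m + 3)) y = 0 := hker _ hv
    have h0 := ih (N y) (by rw [hpow]; exact hy0)
    have h1 := hsp ((N ^ m) x) y
    have h2 : (2 : k) = 0 := CharTwo.two_eq_zero
    rw [hpow, hpow] at h0
    rw [pow_succ', Module.End.mul_apply, ← pow_succ', hy]
    simp only [map_add, hpow, hy0, add_zero]
    push_cast
    linear_combination h1 - h0
      - (B x ((N ^ (m + 1)) y) + (m + 1) * B x ((N ^ (m + 2)) y)) * h2

/-- `V_{≥ -n}` is orthogonal to `N ^ n V_{≥ 1 - n}`. -/
theorem apply_pow_eq_zero_of_mem_canonFilt (halt : B.IsAlt) (hN : IsNilpotent N)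
    (hsp : ∀ x y : V, B (N x) y + B x (N y) + B (N x) (N y) = 0) (n : ℕ) {x v : V}
    (hx : x ∈ canonFilt N (-(n : ℤ))) (hv : v ∈ canonFilt N (1 - (n : ℤ))) :
    B x ((N ^ n) v) = 0 := by
  suffices h : canonFilt N (-(n : ℤ)) ≤ LinearMap.ker (B.flip ((N ^ n) v)) from h hx
  refine iSup_le ?_
  rintro ⟨i, _⟩ _ ⟨u, hu, rfl⟩
  suffices h : canonFilt N (1 - (n : ℤ)) ≤ LinearMap.ker (B ((N ^ i) u) ∘ₗ N ^ n) from h hv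
  refine iSup_le ?_
  rintro ⟨j, _⟩ _ ⟨w, hw, rfl⟩
  simp only [SetLike.mem_coe, LinearMap.mem_ker] at hu hw
  simp only [LinearMap.mem_ker, LinearMap.comp_apply]
  rw [← Module.End.mul_apply, ← pow_add]
  obtain hij | hij := le_or_gt j i
  · refine apply_pow_eq_zero_of_pow_apply_eq_zero hN hsp _ _ _ ?_
    rw [← Module.End.mul_apply, ← pow_add]
    exact Module.End.pow_map_zero_of_le (by omega) hw
  · rw [← neg_eq_zero, halt.neg]
    refine apply_pow_eq_zero_of_pow_apply_eq_zero hN hsp _ _ _ ?_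
    rw [← Module.End.mul_apply, ← pow_add]
    exact Module.End.pow_map_zero_of_le (by omega) hu

end SymplecticUnipotent

/-- (char 2) well-definedness of the quadratic form `q_n`: the value
`⟨x, N^{n−1}x⟩` depends only on the class of `x` modulo `V^N_{≥1−n}` among the
`x ∈ V^N_{≥−n}` with `N^{n+1}x = 0`. -/
theorem stmt_14
    (k : Type*) [Field k] [CharP k 2]
    (V : Type*) [AddCommGroup V] [Module k V]
    [FiniteDimensional k V]
    (B : V →ₗ[k] V →ₗ[k] k)
    (halt : ∀ x : V, B x x = 0)
    (hnd : ∀ x : V, (∀ y : V, B x y = 0) → x = 0)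
    (N : V →ₗ[k] V) (hN : IsNilpotent N)
    (hsp : ∀ x y : V, B (N x) y + B x (N y) + B (N x) (N y) = 0)
    (n : ℕ) (hn2 : 2 ≤ n) (hneven : Even n)
    (hvan : ∀ v ∈ canonFilt N (1 - (n : ℤ)), (N ^ (n + 1)) v = 0 →
      B v ((N ^ (n - 1)) v) = 0) :
    ∀ x x' : V, x ∈ canonFilt N (-(n : ℤ)) → x' ∈ canonFilt N (-(n : ℤ)) →
      (N ^ (n + 1)) x = 0 → (N ^ (n + 1)) x' = 0 →
      x - x' ∈ canonFilt N (1 - (n : ℤ)) →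
      B x ((N ^ (n - 1)) x) = B x' ((N ^ (n - 1)) x') := by
  intro x x' _ hx' hNx hNx' hxx'
  obtain ⟨m, rfl⟩ : ∃ m, n = m + 1 := ⟨n - 1, by omega⟩
  obtain ⟨v, rfl⟩ : ∃ v, x = x' + v := ⟨x - x', by abel⟩
  rw [add_sub_cancel_left] at hxx'
  rw [map_add, hNx', zero_add] at hNx
  have hvv := hvan v hxx' hNx
  have horth := apply_pow_eq_zero_of_mem_canonFilt halt hN hsp (m + 1) hx' hxx'
  have hmove := apply_pow_left_eq_of_pow_add_two hN hsp m x' v hNx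
  have hsymm := LinearMap.IsAlt.neg halt v ((N ^ m) x')
  simp only [Nat.add_sub_cancel, map_add, LinearMap.add_apply] at hvv ⊢
  linear_combination hvv - hsymm - hmove - m * horth
end

section
/- Assume char k = 2. Let ⟨,⟩ be a symplectic form on V and let N be a nilpotent endomorphism of V with 1+N ∈ Sp(⟨,⟩). Let n ≥ 2 be an even integer. Then for all x, y ∈ V^N_{≥−n}: ⟨x+y, N^{n−1}(x+y)⟩ = ⟨x, N^{n−1}x⟩ + ⟨y, N^{n−1}y⟩ + ⟨x, N^n y⟩. -/
section CanonFilt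

variable {k : Type*} [Field k] {V : Type*} [AddCommGroup V] [Module k V]
  {B : V →ₗ[k] V →ₗ[k] k} {N : V →ₗ[k] V}

theorem pow_apply_eq_zero_of_le {s t : ℕ} {v : V} (hv : (N ^ s) v = 0) (h : s ≤ t) :
    (N ^ t) v = 0 := by
  obtain ⟨d, rfl⟩ := Nat.exists_eq_add_of_le' h
  rw [pow_add, Module.End.mul_apply, hv, map_zero]

/-- Moving one power of `N` from the left slot to the right one. -/
theorem form_pow_succ_left [CharP k 2]
    (hsp : ∀ x y : V, B (N x) y + B x (N y) + B (N x) (N y) = 0) (p q : ℕ) (x y : V) :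
    B ((N ^ (p + 1)) x) ((N ^ q) y) =
      B ((N ^ p) x) ((N ^ (q + 1)) y) + B ((N ^ (p + 1)) x) ((N ^ (q + 1)) y) := by
  have h := hsp ((N ^ p) x) ((N ^ q) y)
  simp only [← Module.End.mul_apply, ← pow_succ'] at h
  rw [add_assoc] at h
  exact CharTwo.add_eq_zero.mp h

theorem form_pow_pow_eq_zero_of_right [CharP k 2]
    (hsp : ∀ x y : V, B (N x) y + B x (N y) + B (N x) (N y) = 0) (u : V) {v : V} {s : ℕ}
    (hv : (N ^ s) v = 0) (p q : ℕ) (h : s ≤ p + q) :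
    B ((N ^ p) u) ((N ^ q) v) = 0 := by
  by_cases hq : s ≤ q
  · rw [pow_apply_eq_zero_of_le hv hq, map_zero]
  · obtain ⟨p, rfl⟩ : ∃ p', p = p' + 1 := ⟨p - 1, by omega⟩
    rw [form_pow_succ_left hsp, form_pow_pow_eq_zero_of_right hsp u hv p (q + 1) (by omega),
      form_pow_pow_eq_zero_of_right hsp u hv (p + 1) (q + 1) (by omega), add_zero]
termination_by p + (s - q)
decreasing_by all_goals omega

theorem form_comm_of_alternating [CharP k 2] (halt : ∀ x : V, B x x = 0) (x y : V) :
    B x y = B y x := by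
  have h := halt (x + y)
  simp only [map_add, LinearMap.add_apply, halt, zero_add, add_zero] at h
  exact (CharTwo.add_eq_zero.mp h).symm

theorem form_pow_pow_eq_zero_of_left [CharP k 2] (halt : ∀ x : V, B x x = 0)
    (hsp : ∀ x y : V, B (N x) y + B x (N y) + B (N x) (N y) = 0) {u : V} (v : V) {s : ℕ}
    (hu : (N ^ s) u = 0) (p q : ℕ) (h : s ≤ p + q) :
    B ((N ^ p) u) ((N ^ q) v) = 0 := by
  rw [form_comm_of_alternating halt]
  exact form_pow_pow_eq_zero_of_right hsp v hu q p (by omega)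

theorem canonFilt_neg_induction {n : ℕ} {P : V → Prop}
    (gen : ∀ (j : ℕ) (u : V), (N ^ (2 * j + n + 1)) u = 0 → P ((N ^ j) u))
    (zero : P 0) (add : ∀ x y, P x → P y → P (x + y))
    {x : V} (hx : x ∈ canonFilt N (-(n : ℤ))) : P x := by
  refine Submodule.iSup_induction _ (motive := P) hx ?_ zero add
  rintro ⟨j, _⟩ _ ⟨u, hu, rfl⟩
  refine gen j u ?_
  have e : (2 * (j : ℤ) - -(n : ℤ) + 1).toNat = 2 * j + n + 1 := by omega
  simpa only [e, SetLike.mem_coe, LinearMap.mem_ker] using hu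

/-- The pairing of `N ^ a` and `N ^ b` vanishes on `V^N_{≥-n}` once `a + b > n`. -/
theorem form_pow_pow_eq_zero_of_mem_canonFilt [CharP k 2] (halt : ∀ x : V, B x x = 0)
    (hsp : ∀ x y : V, B (N x) y + B x (N y) + B (N x) (N y) = 0) {n a b : ℕ} (h : n < a + b)
    {x y : V} (hx : x ∈ canonFilt N (-(n : ℤ))) (hy : y ∈ canonFilt N (-(n : ℤ))) :
    B ((N ^ a) x) ((N ^ b) y) = 0 := by
  refine canonFilt_neg_induction (P := fun x => B ((N ^ a) x) ((N ^ b) y) = 0) ?_ (by simp)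
    (fun x x' hx hx' => by simp [hx, hx']) hx
  intro i u hu
  refine canonFilt_neg_induction (P := fun y => B ((N ^ a) ((N ^ i) u)) ((N ^ b) y) = 0) ?_
    (by simp) (fun y y' hy hy' => by simp [hy, hy']) hy
  intro j v hv
  rw [← Module.End.mul_apply, ← Module.End.mul_apply, ← pow_add, ← pow_add]
  rcases le_total i j with hij | hij
  · exact form_pow_pow_eq_zero_of_left halt hsp v hu _ _ (by omega)
  · exact form_pow_pow_eq_zero_of_right hsp u hv _ _ (by omega)

theorem form_pow_pow_eq_of_add_eq [CharP k 2] (halt : ∀ x : V, B x x = 0)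
    (hsp : ∀ x y : V, B (N x) y + B x (N y) + B (N x) (N y) = 0) {n : ℕ}
    {x y : V} (hx : x ∈ canonFilt N (-(n : ℤ))) (hy : y ∈ canonFilt N (-(n : ℤ)))
    (a b : ℕ) (h : a + b = n) :
    B ((N ^ a) x) ((N ^ b) y) = B x ((N ^ n) y) := by
  induction a generalizing b with
  | zero => obtain rfl : b = n := by omega
            simp
  | succ a ih =>
    rw [form_pow_succ_left hsp, ih (b + 1) (by omega),
      form_pow_pow_eq_zero_of_mem_canonFilt halt hsp (by omega) hx hy, add_zero]

theorem form_pow_pow_eq_of_add_add_one_eq [CharP k 2] (halt : ∀ x : V, B x x = 0)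
    (hsp : ∀ x y : V, B (N x) y + B x (N y) + B (N x) (N y) = 0) {n : ℕ}
    {x y : V} (hx : x ∈ canonFilt N (-(n : ℤ))) (hy : y ∈ canonFilt N (-(n : ℤ)))
    (a b : ℕ) (h : a + b + 1 = n) :
    B ((N ^ a) x) ((N ^ b) y) = B x ((N ^ (n - 1)) y) + a * B x ((N ^ n) y) := by
  induction a generalizing b with
  | zero => obtain rfl : b = n - 1 := by omega
            simp
  | succ a ih =>
    rw [form_pow_succ_left hsp, ih (b + 1) (by omega),
      form_pow_pow_eq_of_add_eq halt hsp hx hy (a + 1) (b + 1) (by omega)]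
    push_cast
    ring

end CanonFilt

/-- (char 2) the quadratic-form identity for `q`-type forms: for
`x, y ∈ V^N_{≥−n}` (with `n ≥ 2` even),
`⟨x+y, N^{n−1}(x+y)⟩ = ⟨x, N^{n−1}x⟩ + ⟨y, N^{n−1}y⟩ + ⟨x, N^n y⟩`. -/
theorem stmt_15
    (k : Type*) [Field k] [CharP k 2]
    (V : Type*) [AddCommGroup V] [Module k V]
    [FiniteDimensional k V]
    (B : V →ₗ[k] V →ₗ[k] k)
    (halt : ∀ x : V, B x x = 0)
    (hnd : ∀ x : V, (∀ y : V, B x y = 0) → x = 0)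
    (N : V →ₗ[k] V) (hN : IsNilpotent N)
    (hsp : ∀ x y : V, B (N x) y + B x (N y) + B (N x) (N y) = 0)
    (n : ℕ) (hn2 : 2 ≤ n) (hneven : Even n) :
    ∀ x ∈ canonFilt N (-(n : ℤ)), ∀ y ∈ canonFilt N (-(n : ℤ)),
      B (x + y) ((N ^ (n - 1)) (x + y))
        = B x ((N ^ (n - 1)) x) + B y ((N ^ (n - 1)) y) + B x ((N ^ n) y) := by
  intro x hx y hy
  have h := form_pow_pow_eq_of_add_add_one_eq halt hsp hx hy (n - 1) 0 (by omega)
  have hodd : ((n - 1 : ℕ) : k) = 1 := by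
    rw [CharTwo.natCast_eq_ite, if_neg (by grind)]
  rw [pow_zero, Module.End.one_apply, hodd, one_mul, form_comm_of_alternating halt] at h
  simp only [map_add, LinearMap.add_apply, h]
  linear_combination CharTwo.add_self_eq_zero (B x ((N ^ (n - 1)) y))
end
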